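/- arXiv:math/0601255 — 2 statements merged into one kernel-verified Lean document; each statement's English description precedes it below -/
import Mathlib

section
/- Let T = (AddCircle (1:ℝ)) × (AddCircle (1:ℝ)) be the 2-dimensional torus, let S ⊆ T be a finite set of cardinality m with m ≥ 1, and let x be a point of the complement T \ S. Then the fundamental group of T \ S based at x is isomorphic to the free group on 2·1 + m − 1 = m + 1 generators, i.e., FundamentalGroup (↥(Sᶜ)) x ≃* FreeGroup (Fin (m+1)). -/
section FreeFundamentalGroup

open Set Topology Bundle
open scoped unitInterval

universe u v

/-- The principal bundle with discrete structure group `G` which is trivial over each `B j`, with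
left multiplication by `t k * (t j)⁻¹` as transition functions. -/
def cocycleBundle {X κ G : Type*} [TopologicalSpace X] [Group G] [TopologicalSpace G]
    [DiscreteTopology G] (B : κ → Set X) (hB : ∀ j, IsOpen (B j)) (r : X → κ)
    (hr : ∀ x, x ∈ B (r x)) (t : κ → X → G)
    (ht : ∀ j k, ∀ x ∈ B j ∩ B k, ∀ᶠ y in 𝓝 x, t k y * (t j y)⁻¹ = t k x * (t j x)⁻¹) :
    FiberBundleCore κ X G where
  baseSet := B
  isOpen_baseSet := hB
  indexAt := r
  mem_baseSet_at := hr
  coordChange j k x v := t k x * (t j x)⁻¹ * v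
  coordChange_self j x _ v := by simp
  continuousOn_coordChange j k := by
    rintro ⟨x, v⟩ ⟨hx, -⟩
    refine ContinuousAt.continuousWithinAt (ContinuousAt.congr
      (f := fun p : X × G ↦ t k x * (t j x)⁻¹ * p.2) (by fun_prop) ?_)
    filter_upwards [continuous_fst.continuousAt.eventually (ht j k x hx)] with p hp
    rw [hp]
  coordChange_comp j k l x _ v := by group

/-- Parallel transport in a bundle given by a cocycle, along a path lying in one chart. -/
theorem exists_covering_of_cocycle {X : Type u} {κ : Type*} {G : Type v} [TopologicalSpace X]
    [Group G] (B : κ → Set X) (hB : ∀ j, IsOpen (B j)) (r : X → κ)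
    (hr : ∀ x, x ∈ B (r x)) (t : κ → X → G)
    (ht : ∀ j k, ∀ x ∈ B j ∩ B k, ∀ᶠ y in 𝓝 x, t k y * (t j y)⁻¹ = t k x * (t j x)⁻¹) :
    ∃ (E : Type (max u v)) (_ : TopologicalSpace E) (p : E → X) (cov : IsCoveringMap p)
      (pt : ∀ x, G → p ⁻¹' {x}), (∀ x, Function.Injective (pt x)) ∧
      ∀ (j : κ) (x y : X) (γ : Path x y), (∀ s, γ s ∈ B j) → ∀ g,
        cov.monodromy (.mk γ) (pt x g) = pt y ((t j y)⁻¹ * t j x * g) := by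
  let : TopologicalSpace G := ⊥
  have : DiscreteTopology G := ⟨rfl⟩
  let Z := cocycleBundle B hB r hr t ht
  let pt : ∀ x, G → Z.proj ⁻¹' {x} := fun x g ↦ ⟨⟨x, (t (r x) x * g : G)⟩, rfl⟩
  have cov : IsCoveringMap Z.proj := FiberBundle.isCoveringMap (F := G) (E := Z.Fiber)
  refine ⟨Z.TotalSpace, inferInstance, Z.proj, cov, pt, ?_, ?_⟩
  · intro x g h hgh
    have h1 := congrArg Subtype.val hgh
    have h2 := eq_of_heq (TotalSpace.mk.inj h1).2
    exact mul_left_cancel h2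
  · intro j x y γ hγ g
    let c : G := t j x * g
    have hpt : ∀ s, (pt (γ s) ((t j (γ s))⁻¹ * c)).1 =
        (Z.localTriv j).toOpenPartialHomeomorph.symm (γ s, c) := by
      intro s
      refine congrArg (TotalSpace.mk (γ s)) ?_
      change t (r (γ s)) (γ s) * ((t j (γ s))⁻¹ * c) = t (r (γ s)) (γ s) * (t j (γ s))⁻¹ * c
      group
    have hx : (pt x ((t j x)⁻¹ * c)) = pt x g := by simp [c]
    have hcont : Continuous fun s ↦ (pt (γ s) ((t j (γ s))⁻¹ * c)).1 := by
      simp_rw [hpt]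
      refine (Z.localTriv j).toOpenPartialHomeomorph.continuousOn_symm.comp_continuous
        (by fun_prop) fun s ↦ ?_
      exact (Z.mem_localTriv_target j _).2 (hγ s)
    let Γ : Path (pt x g).1 (pt y ((t j y)⁻¹ * t j x * g)).1 :=
      { toFun s := (pt (γ s) ((t j (γ s))⁻¹ * c)).1
        continuous_toFun := hcont
        source' := by rw [γ.source, hx]
        target' := by rw [γ.target, mul_assoc] }
    exact cov.monodromy_eq_of_map_eq (γ := .mk γ) (ex := pt x g)
      (ey := pt y ((t j y)⁻¹ * t j x * g)) (.mk Γ) rfl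

/-- A property of homotopy classes of paths which is stable under concatenation and holds for the
paths lying in a member of an open cover holds for all paths. -/
theorem Path.Homotopic.Quotient.induction_of_open_cover {X κ : Type*} [TopologicalSpace X]
    {B : κ → Set X} (hB : ∀ j, IsOpen (B j)) (hcover : ∀ x, ∃ j, x ∈ B j)
    {C : ∀ x y : X, Path.Homotopic.Quotient x y → Prop}
    (htrans : ∀ {x y z} (p : Path.Homotopic.Quotient x y) (q : Path.Homotopic.Quotient y z),
      C x y p → C y z q → C x z (p.trans q))
    (hmem : ∀ j {x y} (γ : Path x y), (∀ s, γ s ∈ B j) → C x y (.mk γ))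
    {x y : X} (p : Path.Homotopic.Quotient x y) : C x y p := by
  induction p with | mk γ => ?_
  obtain ⟨t, ht0, hmono, ⟨n, hn⟩, hsub⟩ := exists_monotone_Icc_subset_open_cover_unitInterval
    (c := fun j ↦ γ ⁻¹' B j) (fun j ↦ (hB j).preimage γ.continuous)
    fun s _ ↦ mem_iUnion.2 (hcover (γ s))
  have hstep (k : ℕ) : C _ _ (.mk (γ.subpath (t k) (t (k + 1)))) := by
    obtain ⟨j, hj⟩ := hsub k
    refine hmem j _ fun s ↦ ?_
    have hs : γ.subpath (t k) (t (k + 1)) s ∈ range (γ.subpath (t k) (t (k + 1))) := ⟨s, rfl⟩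
    rw [γ.range_subpath_of_le _ _ (hmono k.le_succ)] at hs
    obtain ⟨u, hu, hus⟩ := hs
    exact hus ▸ hj hu
  have hall (k : ℕ) : C _ _ (.mk (γ.subpath (t 0) (t (k + 1)))) := by
    induction k with
    | zero => exact hstep 0
    | succ k ih =>
      have := htrans _ _ ih (hstep (k + 1))
      rwa [← Path.Homotopic.Quotient.mk_trans, Path.Homotopic.Quotient.eq.2
        ⟨Path.Homotopy.subpathTransSubpath γ _ _ _⟩] at this
  have h1 := hall n
  rw [ht0, hn (n + 1) n.le_succ, Path.subpath_zero_one] at h1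
  have hcast : ∀ a b (ha : a = x) (hb : b = y), C a b (.mk (γ.cast ha hb)) → C x y (.mk γ) := by
    rintro _ _ rfl rfl h
    exact h
  exact hcast _ _ _ _ h1

section SimplyConnected

variable {X : Type*} [TopologicalSpace X] {W : Set X}

theorem IsSimplyConnected.homotopic (hW : IsSimplyConnected W) {x y : X} (p q : Path x y)
    (hp : ∀ s, p s ∈ W) (hq : ∀ s, q s ∈ W) : p.Homotopic q := by
  have := hW.simplyConnectedSpace
  have hx : x ∈ W := p.source ▸ hp 0
  have hy : y ∈ W := p.target ▸ hp 1
  let lift (r : Path x y) (hr : ∀ s, r s ∈ W) : Path (⟨x, hx⟩ : W) ⟨y, hy⟩ :=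
    { toFun s := ⟨r s, hr s⟩
      source' := by simp
      target' := by simp }
  exact (SimplyConnectedSpace.paths_homotopic (lift p hp) (lift q hq)).map
    ⟨Subtype.val, continuous_subtype_val⟩

/-- The homotopy class of the paths between two points of a simply connected set which stay in
that set. -/
noncomputable def IsSimplyConnected.pathClass (hW : IsSimplyConnected W) {x y : X} (hx : x ∈ W)
    (hy : y ∈ W) : Path.Homotopic.Quotient x y :=
  .mk (hW.isPathConnected.joinedIn x hx y hy).somePath

theorem IsSimplyConnected.mk_eq_pathClass (hW : IsSimplyConnected W) {x y : X} (p : Path x y)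
    (hp : ∀ s, p s ∈ W) (hx : x ∈ W) (hy : y ∈ W) : .mk p = hW.pathClass hx hy :=
  Path.Homotopic.Quotient.eq.2 (hW.homotopic _ _ hp (JoinedIn.somePath_mem _))

theorem IsSimplyConnected.pathClass_trans (hW : IsSimplyConnected W) {x y z : X} (hx : x ∈ W)
    (hy : y ∈ W) (hz : z ∈ W) :
    (hW.pathClass hx hy).trans (hW.pathClass hy hz) = hW.pathClass hx hz := by
  refine hW.mk_eq_pathClass (.trans _ _) (fun s ↦ ?_) hx hz
  rw [Path.trans_apply]
  split_ifs <;> exact JoinedIn.somePath_mem _ _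

theorem IsSimplyConnected.pathClass_symm (hW : IsSimplyConnected W) {x y : X} (hx : x ∈ W)
    (hy : y ∈ W) : (hW.pathClass hx hy).symm = hW.pathClass hy hx :=
  hW.mk_eq_pathClass (.symm _) (fun _ ↦ JoinedIn.somePath_mem _ _) hy hx

theorem IsSimplyConnected.pathClass_self (hW : IsSimplyConnected W) {x : X} (hx : x ∈ W) :
    hW.pathClass hx hx = .refl x :=
  (hW.mk_eq_pathClass (.refl x) (fun _ ↦ hx) hx hx).symm

theorem IsSimplyConnected.pathClass_eq_of_subset {W' M : Set X} (hW : IsSimplyConnected W)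
    (hW' : IsSimplyConnected W') (hM : IsPathConnected M) (hMW : M ⊆ W) (hMW' : M ⊆ W') {x y : X}
    (hx : x ∈ M) (hy : y ∈ M) :
    hW.pathClass (hMW hx) (hMW hy) = hW'.pathClass (hMW' hx) (hMW' hy) := by
  have h := hM.joinedIn x hx y hy
  rw [← hW.mk_eq_pathClass h.somePath fun s ↦ hMW (h.somePath_mem s),
    ← hW'.mk_eq_pathClass h.somePath fun s ↦ hMW' (h.somePath_mem s)]

end SimplyConnected

/-- A space cut open into a simply connected open set `U` by disjoint walls: `V i` is a simply
connected neighbourhood of the `i`-th wall, whose two sides are `N i` and `P i`. -/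
structure IsCutSystem {X ι : Type*} [TopologicalSpace X] (U : Set X) (V N P : ι → Set X) :
    Prop where
  isOpen_base : IsOpen U
  simplyConnected_base : IsSimplyConnected U
  isOpen_wall (i) : IsOpen (V i)
  simplyConnected_wall (i) : IsSimplyConnected (V i)
  isOpen_neg (i) : IsOpen (N i)
  isPathConnected_neg (i) : IsPathConnected (N i)
  neg_subset_base (i) : N i ⊆ U
  neg_subset_wall (i) : N i ⊆ V i
  isOpen_pos (i) : IsOpen (P i)
  isPathConnected_pos (i) : IsPathConnected (P i)
  pos_subset_base (i) : P i ⊆ U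
  pos_subset_wall (i) : P i ⊆ V i
  disjoint_sides (i) : Disjoint (N i) (P i)
  inter_subset_sides (i) : U ∩ V i ⊆ N i ∪ P i
  inter_wall_subset {i j} : i ≠ j → V i ∩ V j ⊆ U
  cover (x) : x ∈ U ∨ ∃ i, x ∈ V i

namespace IsCutSystem

variable {X ι : Type*} [TopologicalSpace X] {U : Set X} {V N P : ι → Set X}

theorem exists_wall (h : IsCutSystem U V N P) (x : X) : ∃ j : Option ι, x ∈ j.elim U V := by
  obtain hx | ⟨i, hx⟩ := h.cover x
  exacts [⟨none, hx⟩, ⟨some i, hx⟩]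

section FreeGroup

variable (h : IsCutSystem U V N P) {b : X} (hb : b ∈ U)

/-- The base point chosen on the negative side of a wall. -/
noncomputable def negPt (i : ι) : X := (h.isPathConnected_neg i).nonempty.some

/-- The base point chosen on the positive side of a wall. -/
noncomputable def posPt (i : ι) : X := (h.isPathConnected_pos i).nonempty.some

theorem negPt_mem (i : ι) : h.negPt i ∈ N i := (h.isPathConnected_neg i).nonempty.some_mem

theorem posPt_mem (i : ι) : h.posPt i ∈ P i := (h.isPathConnected_pos i).nonempty.some_mem

/-- The class of the paths in `U` from the base point to the negative side of a wall. -/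
noncomputable def toNeg (i : ι) : Path.Homotopic.Quotient b (h.negPt i) :=
  h.simplyConnected_base.pathClass hb (h.neg_subset_base i (h.negPt_mem i))

/-- The class of the paths in `U` from the base point to the positive side of a wall. -/
noncomputable def toPos (i : ι) : Path.Homotopic.Quotient b (h.posPt i) :=
  h.simplyConnected_base.pathClass hb (h.pos_subset_base i (h.posPt_mem i))

/-- The class of the paths crossing a wall from its negative to its positive side. -/
noncomputable def cross (i : ι) : Path.Homotopic.Quotient (h.negPt i) (h.posPt i) :=
  (h.simplyConnected_wall i).pathClass (h.neg_subset_wall i (h.negPt_mem i))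
    (h.pos_subset_wall i (h.posPt_mem i))

/-- The class of the loops which cross one wall, once, in the positive direction. -/
noncomputable def loop (i : ι) : FundamentalGroup X b :=
  ((h.toNeg hb i).trans (h.cross i)).trans (h.toPos hb i).symm

/-- The homomorphism sending each generator to the loop crossing the corresponding wall. -/
noncomputable def freeGroupHom : FreeGroup ι →* FundamentalGroup X b :=
  FreeGroup.lift (h.loop hb)

theorem loop_mem_range (i : ι) : h.loop hb i ∈ (h.freeGroupHom hb).range :=
  ⟨.of i, by simp [freeGroupHom]⟩

theorem exists_transport : ∃ c : ∀ x, Path.Homotopic.Quotient b x,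
    (∀ x (hx : x ∈ U), c x = h.simplyConnected_base.pathClass hb hx) ∧
    ∀ x, x ∉ U → ∀ i (hx : x ∈ V i), c x = (h.toNeg hb i).trans
      ((h.simplyConnected_wall i).pathClass (h.neg_subset_wall i (h.negPt_mem i)) hx) := by
  have key (x : X) : ∃ c : Path.Homotopic.Quotient b x,
      (∀ hx : x ∈ U, c = h.simplyConnected_base.pathClass hb hx) ∧
      (x ∉ U → ∀ i (hx : x ∈ V i), c = (h.toNeg hb i).trans
        ((h.simplyConnected_wall i).pathClass (h.neg_subset_wall i (h.negPt_mem i)) hx)) := by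
    by_cases hxU : x ∈ U
    · exact ⟨h.simplyConnected_base.pathClass hb hxU, fun _ ↦ rfl, fun hx ↦ absurd hxU hx⟩
    · obtain ⟨i, hi⟩ := (h.cover x).resolve_left hxU
      refine ⟨(h.toNeg hb i).trans ((h.simplyConnected_wall i).pathClass
        (h.neg_subset_wall i (h.negPt_mem i)) hi), fun hx ↦ absurd hx hxU, fun _ j hj ↦ ?_⟩
      obtain rfl : i = j := by
        by_contra hij
        exact hxU (h.inter_wall_subset hij ⟨hi, hj⟩)
      rfl
  choose c hc1 hc2 using key
  exact ⟨c, hc1, hc2⟩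

theorem exists_transport_eq_of_mem_wall {c : ∀ x, Path.Homotopic.Quotient b x}
    (hcU : ∀ x (hx : x ∈ U), c x = h.simplyConnected_base.pathClass hb hx)
    (hcV : ∀ x, x ∉ U → ∀ i (hx : x ∈ V i), c x = (h.toNeg hb i).trans
      ((h.simplyConnected_wall i).pathClass (h.neg_subset_wall i (h.negPt_mem i)) hx))
    {x : X} {i : ι} (hx : x ∈ V i) :
    ∃ g ∈ (h.freeGroupHom hb).range, c x = Path.Homotopic.Quotient.trans g ((h.toNeg hb i).trans
      ((h.simplyConnected_wall i).pathClass (h.neg_subset_wall i (h.negPt_mem i)) hx)) := by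
  by_cases hxU : x ∈ U
  swap
  · refine ⟨1, one_mem _, ?_⟩
    rw [hcV x hxU i hx, FundamentalGroup.one_def, Path.Homotopic.Quotient.refl_trans]
  rw [hcU x hxU]
  rcases h.inter_subset_sides i ⟨hxU, hx⟩ with hxN | hxP
  · refine ⟨1, one_mem _, ?_⟩
    rw [FundamentalGroup.one_def, Path.Homotopic.Quotient.refl_trans,
      ← h.simplyConnected_base.pathClass_eq_of_subset (h.simplyConnected_wall i)
        (h.isPathConnected_neg i) (h.neg_subset_base i) (h.neg_subset_wall i) (h.negPt_mem i) hxN]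
    exact (h.simplyConnected_base.pathClass_trans _ _ _).symm
  · refine ⟨(h.loop hb i)⁻¹, inv_mem (h.loop_mem_range hb i), ?_⟩
    have h1 : (h.toPos hb i).trans ((h.simplyConnected_wall i).pathClass
        (h.pos_subset_wall i (h.posPt_mem i)) hx) = h.simplyConnected_base.pathClass hb hxU := by
      rw [← h.simplyConnected_base.pathClass_eq_of_subset (h.simplyConnected_wall i)
        (h.isPathConnected_pos i) (h.pos_subset_base i) (h.pos_subset_wall i) (h.posPt_mem i) hxP]
      exact h.simplyConnected_base.pathClass_trans _ _ _
    have h2 : (h.cross i).trans ((h.simplyConnected_wall i).pathClass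
        (h.pos_subset_wall i (h.posPt_mem i)) hx) = _ :=
      (h.simplyConnected_wall i).pathClass_trans (h.neg_subset_wall i (h.negPt_mem i)) _ _
    have h3 : (h.toNeg hb i).trans (h.cross i) =
        Path.Homotopic.Quotient.trans (h.loop hb i) (h.toPos hb i) := by
      simp [loop]
    rw [← h2, ← Path.Homotopic.Quotient.trans_assoc (h.toNeg hb i), h3, ← h1,
      FundamentalGroup.inv_def]
    rw [← Path.Homotopic.Quotient.trans_assoc, ← Path.Homotopic.Quotient.trans_assoc,
      Path.Homotopic.Quotient.symm_trans, Path.Homotopic.Quotient.refl_trans]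

theorem freeGroupHom_surjective : Function.Surjective (h.freeGroupHom hb) := by
  obtain ⟨c, hcU, hcV⟩ := h.exists_transport hb
  have key : ∀ {x y : X} (p : Path.Homotopic.Quotient x y),
      ∃ g ∈ (h.freeGroupHom hb).range, (c x).trans p = Path.Homotopic.Quotient.trans g (c y) := by
    refine Path.Homotopic.Quotient.induction_of_open_cover (B := fun j ↦ Option.elim j U V)
      (C := fun x y p ↦ ∃ g ∈ (h.freeGroupHom hb).range,
        (c x).trans p = Path.Homotopic.Quotient.trans g (c y))
      (Option.forall.2 ⟨h.isOpen_base, h.isOpen_wall⟩) h.exists_wall ?_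
      (Option.forall.2 ⟨?_, ?_⟩)
    · rintro x y z p q ⟨g, hg, hp⟩ ⟨k, hk, hq⟩
      refine ⟨k * g, mul_mem hk hg, ?_⟩
      rw [FundamentalGroup.mul_def, ← Path.Homotopic.Quotient.trans_assoc, hp,
        Path.Homotopic.Quotient.trans_assoc, hq, Path.Homotopic.Quotient.trans_assoc]
    · intro x y γ hγ
      have hx : x ∈ U := γ.source ▸ hγ 0
      have hy : y ∈ U := γ.target ▸ hγ 1
      refine ⟨1, one_mem _, ?_⟩
      rw [hcU x hx, hcU y hy, h.simplyConnected_base.mk_eq_pathClass γ hγ hx hy,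
        h.simplyConnected_base.pathClass_trans, FundamentalGroup.one_def,
        Path.Homotopic.Quotient.refl_trans]
    · intro i x y γ hγ
      have hx : x ∈ V i := γ.source ▸ hγ 0
      have hy : y ∈ V i := γ.target ▸ hγ 1
      obtain ⟨g, hg, hgx⟩ := h.exists_transport_eq_of_mem_wall hb hcU hcV hx
      obtain ⟨k, hk, hky⟩ := h.exists_transport_eq_of_mem_wall hb hcU hcV hy
      refine ⟨k⁻¹ * g, mul_mem (inv_mem hk) hg, ?_⟩
      rw [hgx, hky, (h.simplyConnected_wall i).mk_eq_pathClass γ hγ hx hy,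
        Path.Homotopic.Quotient.trans_assoc, Path.Homotopic.Quotient.trans_assoc,
        (h.simplyConnected_wall i).pathClass_trans, FundamentalGroup.mul_def,
        FundamentalGroup.inv_def, Path.Homotopic.Quotient.trans_assoc g,
        ← Path.Homotopic.Quotient.trans_assoc (Path.Homotopic.Quotient.symm k),
        Path.Homotopic.Quotient.symm_trans, Path.Homotopic.Quotient.refl_trans]
  intro p
  obtain ⟨g, ⟨w, rfl⟩, hw⟩ := key p
  rw [hcU b hb, h.simplyConnected_base.pathClass_self, Path.Homotopic.Quotient.refl_trans,
    Path.Homotopic.Quotient.trans_refl] at hw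
  exact ⟨w, hw.symm⟩

theorem freeGroupHom_injective : Function.Injective (h.freeGroupHom hb) := by
  classical
  let t : Option ι → X → FreeGroup ι := fun j x ↦
    j.elim 1 fun i ↦ if x ∈ P i then (FreeGroup.of i)⁻¹ else 1
  have hconst (i : ι) (x : X) (hxU : x ∈ U) (hxV : x ∈ V i) :
      ∀ᶠ y in 𝓝 x, t (some i) y = t (some i) x := by
    rcases h.inter_subset_sides i ⟨hxU, hxV⟩ with hx | hx
    · filter_upwards [(h.isOpen_neg i).mem_nhds hx] with y hy
      simp [t, (h.disjoint_sides i).notMem_of_mem_left hx,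
        (h.disjoint_sides i).notMem_of_mem_left hy]
    · filter_upwards [(h.isOpen_pos i).mem_nhds hx] with y hy
      simp [t, hx, hy]
  choose r hr using h.exists_wall
  obtain ⟨E, _, p, cov, pt, hpt, hmono⟩ := exists_covering_of_cocycle
    (fun j : Option ι ↦ j.elim U V) (Option.forall.2 ⟨h.isOpen_base, h.isOpen_wall⟩) r hr t (by
      rintro (_ | i) (_ | j) x ⟨hx, hx'⟩
      · exact .of_forall fun _ ↦ rfl
      · filter_upwards [hconst j x hx hx'] with y hy
        rw [hy]; rfl
      · filter_upwards [hconst i x hx' hx] with y hy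
        rw [hy]; rfl
      · obtain rfl | hij := eq_or_ne i j
        · exact .of_forall fun _ ↦ by simp
        · have hxU := h.inter_wall_subset hij ⟨hx, hx'⟩
          filter_upwards [hconst i x hxU hx, hconst j x hxU hx'] with y hi hj
          rw [hi, hj])
  have hmonoU {x y : X} (hx : x ∈ U) (hy : y ∈ U) (g : FreeGroup ι) :
      cov.monodromy (h.simplyConnected_base.pathClass hx hy) (pt x g) = pt y g := by
    simpa [t] using! hmono none x y
      (h.simplyConnected_base.isPathConnected.joinedIn x hx y hy).somePath
        (fun s ↦ JoinedIn.somePath_mem _ s) g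
  have hcross (i : ι) (g : FreeGroup ι) :
      cov.monodromy (h.cross i) (pt (h.negPt i) g) = pt (h.posPt i) (.of i * g) := by
    have h1 := (h.disjoint_sides i).notMem_of_mem_left (h.negPt_mem i)
    have h2 := h.posPt_mem i
    simpa [t, h1, h2] using! hmono (some i) (h.negPt i) (h.posPt i)
      ((h.simplyConnected_wall i).isPathConnected.joinedIn _ (h.neg_subset_wall i (h.negPt_mem i))
        _ (h.pos_subset_wall i (h.posPt_mem i))).somePath
      (fun s ↦ JoinedIn.somePath_mem _ s) g
  have hloop (i : ι) (g : FreeGroup ι) :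
      cov.monodromyPerm b (h.loop hb i) (pt b g) = pt b (.of i * g) := by
    rw [cov.coe_monodromyPerm, loop, cov.monodromy_trans_apply, cov.monodromy_trans_apply, toNeg,
      hmonoU, hcross, toPos, IsSimplyConnected.pathClass_symm, hmonoU]
  have hall (w g : FreeGroup ι) :
      cov.monodromyPerm b (h.freeGroupHom hb w) (pt b g) = pt b (w * g) := by
    induction w using FreeGroup.induction_on generalizing g with
    | C1 => rw [map_one, map_one, Equiv.Perm.one_apply, one_mul]
    | of i => simpa [freeGroupHom] using! hloop i g
    | inv_of i ih =>
      rw [map_inv, map_inv, Equiv.Perm.inv_eq_iff_eq, ih, mul_inv_cancel_left]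
    | mul v w hv hw => rw [map_mul, map_mul, Equiv.Perm.mul_apply, hw, hv, mul_assoc]
  refine (injective_iff_map_eq_one _).2 fun w hw ↦ ?_
  have h1 := hall w 1
  rw [hw, map_one, Equiv.Perm.one_apply, mul_one] at h1
  exact (hpt b h1).symm

end FreeGroup

/-- The fundamental group of a cut system is free on the set of walls. -/
theorem nonempty_fundamentalGroup_mulEquiv (h : IsCutSystem U V N P) {b : X} (hb : b ∈ U) :
    Nonempty (FundamentalGroup X b ≃* FreeGroup ι) :=
  ⟨(MulEquiv.ofBijective (h.freeGroupHom hb)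
    ⟨h.freeGroupHom_injective hb, h.freeGroupHom_surjective hb⟩).symm⟩

theorem pathConnectedSpace (h : IsCutSystem U V N P) : PathConnectedSpace X := by
  obtain ⟨b, hb⟩ := h.simplyConnected_base.nonempty
  obtain ⟨c, -⟩ := h.exists_transport hb
  have hj (x : X) : Joined b x := ⟨(c x).out⟩
  exact ⟨⟨b⟩, fun x y ↦ (hj x).symm.trans (hj y)⟩

end IsCutSystem

section Torus

/-- Two real numbers at distance less than one with the same image in the circle agree. -/
theorem AddCircle.eq_of_coe_eq {s t : ℝ} (hst : (s : AddCircle (1 : ℝ)) = t) (h1 : s - t < 1)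
    (h2 : t - s < 1) : s = t := by
  rw [← sub_eq_zero, ← AddCircle.coe_sub, AddCircle.coe_eq_zero_iff] at hst
  obtain ⟨n, hn⟩ := hst
  rw [zsmul_eq_mul, mul_one] at hn
  have hn1 : n < 1 := by exact_mod_cast hn ▸ h1
  have hn2 : -1 < n := by
    have : (-1 : ℝ) < n := by linarith
    exact_mod_cast this
  obtain rfl : n = 0 := by lia
  rw [Int.cast_zero] at hn
  linarith

theorem AddCircle.exists_coe_eq_of_mem_Ico (u : AddCircle (1 : ℝ)) :
    ∃ s ∈ Ico (0 : ℝ) 1, (s : AddCircle (1 : ℝ)) = u := by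
  have h : u ∈ (univ : Set (AddCircle (1 : ℝ))) := mem_univ u
  rw [← AddCircle.coe_image_Ico_eq 1 0, zero_add] at h
  exact h

/-- The covering of the torus by the plane. -/
def planeToTorus (p : ℝ × ℝ) : AddCircle (1 : ℝ) × AddCircle (1 : ℝ) := (p.1, p.2)

/-- The image in the torus of an open rectangle. -/
def torusRect (a b c d : ℝ) : Set (AddCircle (1 : ℝ) × AddCircle (1 : ℝ)) :=
  planeToTorus '' (Ioo a b ×ˢ Ioo c d)

theorem mem_torusRect {a b c d s t : ℝ} (hs : s ∈ Ioo a b) (ht : t ∈ Ioo c d) :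
    ((s : AddCircle (1 : ℝ)), (t : AddCircle (1 : ℝ))) ∈ torusRect a b c d :=
  ⟨(s, t), ⟨hs, ht⟩, rfl⟩

theorem isOpenMap_planeToTorus : IsOpenMap planeToTorus :=
  QuotientAddGroup.isOpenMap_coe.prodMap QuotientAddGroup.isOpenMap_coe

theorem continuous_planeToTorus : Continuous planeToTorus :=
  (AddCircle.continuous_mk' 1).prodMap (AddCircle.continuous_mk' 1)

theorem isOpen_torusRect (a b c d : ℝ) : IsOpen (torusRect a b c d) :=
  isOpenMap_planeToTorus _ (isOpen_Ioo.prod isOpen_Ioo)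

theorem torusRect_mono {a b c d a' b' c' d' : ℝ} (h1 : a' ≤ a) (h2 : b ≤ b') (h3 : c' ≤ c)
    (h4 : d ≤ d') : torusRect a b c d ⊆ torusRect a' b' c' d' :=
  image_mono (prod_mono (Ioo_subset_Ioo h1 h2) (Ioo_subset_Ioo h3 h4))

theorem torusRect_add_one_left (a b c d : ℝ) :
    torusRect (a + 1) (b + 1) c d = torusRect a b c d := by
  ext ⟨u, v⟩
  constructor
  · rintro ⟨⟨s, t⟩, ⟨hs, ht⟩, hp⟩
    refine ⟨(s - 1, t), ⟨⟨by linarith [hs.1], by linarith [hs.2]⟩, ht⟩, ?_⟩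
    rw [← hp]
    simp [planeToTorus]
  · rintro ⟨⟨s, t⟩, ⟨hs, ht⟩, hp⟩
    refine ⟨(s + 1, t), ⟨⟨by linarith [hs.1], by linarith [hs.2]⟩, ht⟩, ?_⟩
    rw [← hp]
    simp [planeToTorus]

theorem torusRect_add_one_right (a b c d : ℝ) :
    torusRect a b (c + 1) (d + 1) = torusRect a b c d := by
  ext ⟨u, v⟩
  constructor
  · rintro ⟨⟨s, t⟩, ⟨hs, ht⟩, hp⟩
    refine ⟨(s, t - 1), ⟨hs, ⟨by linarith [ht.1], by linarith [ht.2]⟩⟩, ?_⟩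
    rw [← hp]
    simp [planeToTorus]
  · rintro ⟨⟨s, t⟩, ⟨hs, ht⟩, hp⟩
    refine ⟨(s, t + 1), ⟨hs, ⟨by linarith [ht.1], by linarith [ht.2]⟩⟩, ?_⟩
    rw [← hp]
    simp [planeToTorus]

theorem isSimplyConnected_torusRect {a b c d : ℝ} (hab : a < b) (hb : b ≤ a + 1) (hcd : c < d)
    (hd : d ≤ c + 1) : IsSimplyConnected (torusRect a b c d) := by
  let C : Set (ℝ × ℝ) := Ioo a b ×ˢ Ioo c d
  have hC : IsOpen C := isOpen_Ioo.prod isOpen_Ioo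
  have hinj : Function.Injective fun p : C ↦ planeToTorus p := by
    rintro ⟨⟨s, t⟩, hs, ht⟩ ⟨⟨s', t'⟩, hs', ht'⟩ hp
    simp only [planeToTorus, Prod.mk.injEq] at hp
    simp only [mem_Ioo] at hs ht hs' ht'
    have h1 := AddCircle.eq_of_coe_eq hp.1 (by linarith) (by linarith)
    have h2 := AddCircle.eq_of_coe_eq hp.2 (by linarith) (by linarith)
    simp [h1, h2]
  have hemb : IsEmbedding fun p : C ↦ planeToTorus p :=
    (IsOpenEmbedding.of_continuous_injective_isOpenMap
      (continuous_planeToTorus.comp continuous_subtype_val) hinj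
      (isOpenMap_planeToTorus.comp hC.isOpenMap_subtype_val)).isEmbedding
  have hconv : Convex ℝ C := (convex_Ioo a b).prod (convex_Ioo c d)
  have hne : C.Nonempty := (nonempty_Ioo.2 hab).prod (nonempty_Ioo.2 hcd)
  have := hconv.contractibleSpace hne
  have hrange : torusRect a b c d = range fun p : C ↦ planeToTorus p := by
    rw [torusRect, image_eq_range]
  rw [hrange]
  exact hemb.toHomeomorph.symm.toHomotopyEquiv.simplyConnectedSpace

/-- The torus punctured at the points `(i / m, 0)` is cut open into a square by the segments
between consecutive punctures and the vertical segment from the first puncture to itself. -/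
theorem exists_isCutSystem_of_punctures {X : Type*} [TopologicalSpace X] {m : ℕ} (hm : 1 ≤ m)
    {f : X → AddCircle (1 : ℝ) × AddCircle (1 : ℝ)} (hf : IsEmbedding f)
    (hrange : ∀ p, p ∈ range f ↔
      ∀ i : Fin m, p ≠ (((i / m : ℝ) : AddCircle (1 : ℝ)), ((0 : ℝ) : AddCircle (1 : ℝ)))) :
    ∃ (U : Set X) (V N P : Option (Fin m) → Set X), IsCutSystem U V N P := by
  have hm0 : (0 : ℝ) < m := by exact_mod_cast hm
  have hpos (i : Fin m) : 0 ≤ (i / m : ℝ) := by positivity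
  have hlt (i : Fin m) : (i / m : ℝ) < (i + 1) / m := by gcongr; linarith
  have hle (i : Fin m) : ((i + 1) / m : ℝ) ≤ 1 := by
    rw [div_le_one hm0]
    exact_mod_cast i.2
  have hsep {i j : Fin m} {s : ℝ} (hi : s ∈ Ioo (i / m : ℝ) ((i + 1) / m))
      (hj : s ∈ Ico (j / m : ℝ) ((j + 1) / m)) : i = j ∧ s ≠ j / m := by
    have h1 : (i : ℝ) < j + 1 := (div_lt_div_iff_of_pos_right hm0).1 (hi.1.trans hj.2)
    have h2 : (j : ℝ) < i + 1 := (div_lt_div_iff_of_pos_right hm0).1 (hj.1.trans_lt hi.2)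
    have h1' : (i : ℕ) < j + 1 := by exact_mod_cast h1
    have h2' : (j : ℕ) < i + 1 := by exact_mod_cast h2
    obtain rfl : i = j := Fin.ext (by lia)
    exact ⟨rfl, hi.1.ne'⟩
  have hopen (a b c d : ℝ) : IsOpen (f ⁻¹' torusRect a b c d) :=
    (isOpen_torusRect a b c d).preimage hf.continuous
  have hsc {a b c d : ℝ} (hab : a < b) (hb : b ≤ a + 1) (hcd : c < d) (hd : d ≤ c + 1)
      (hsub : torusRect a b c d ⊆ range f) : IsSimplyConnected (f ⁻¹' torusRect a b c d) := by
    rw [← hf.isSimplyConnected_image, image_preimage_eq_of_subset hsub]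
    exact isSimplyConnected_torusRect hab hb hcd hd
  have hstrip (a b : ℝ) : torusRect a b 0 1 ⊆ range f := by
    rintro _ ⟨⟨s, t⟩, ⟨hs, ht⟩, rfl⟩
    refine (hrange _).2 fun i hi ↦ ht.1.ne' ?_
    exact AddCircle.eq_of_coe_eq (Prod.mk.inj hi).2 (by linarith [ht.2]) (by linarith [ht.1])
  have hwindow (i : Fin m) : torusRect (i / m) ((i + 1) / m) (-(1 / 2)) (1 / 2) ⊆ range f := by
    rintro _ ⟨⟨s, t⟩, ⟨hs, ht⟩, rfl⟩
    refine (hrange _).2 fun j hj ↦ ?_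
    have h1 : s = j / m := AddCircle.eq_of_coe_eq (Prod.mk.inj hj).1
      (by linarith [hs.2, hle i, hpos j]) (by linarith [hs.1, hlt j, hle j, hpos i])
    exact (hsep hs ⟨h1.ge, h1 ▸ hlt j⟩).2 h1
  have hwindow_base (i : Fin m) :
      torusRect (i / m) ((i + 1) / m) (-(1 / 2)) 0 ⊆ torusRect 0 1 0 1 := by
    rw [← torusRect_add_one_right]
    exact torusRect_mono (hpos i) (hle i) (by norm_num) (by norm_num)
  have hstrip_base : torusRect (-(1 / 2)) 0 0 1 ⊆ torusRect 0 1 0 1 := by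
    rw [← torusRect_add_one_left]
    exact torusRect_mono (by norm_num) (by norm_num) le_rfl le_rfl
  refine ⟨f ⁻¹' torusRect 0 1 0 1,
    fun o ↦ f ⁻¹' o.elim (torusRect (-(1 / 2)) (1 / 2) 0 1)
      fun i ↦ torusRect (i / m) ((i + 1) / m) (-(1 / 2)) (1 / 2),
    fun o ↦ f ⁻¹' o.elim (torusRect (-(1 / 2)) 0 0 1)
      fun i ↦ torusRect (i / m) ((i + 1) / m) (-(1 / 2)) 0,
    fun o ↦ f ⁻¹' o.elim (torusRect 0 (1 / 2) 0 1)
      fun i ↦ torusRect (i / m) ((i + 1) / m) 0 (1 / 2), ?_⟩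
  constructor
  case isOpen_base => exact hopen _ _ _ _
  case simplyConnected_base =>
    exact hsc one_pos (by norm_num) one_pos (by norm_num) (hstrip _ _)
  case isOpen_wall => exact Option.forall.2 ⟨hopen _ _ _ _, fun _ ↦ hopen _ _ _ _⟩
  case isOpen_neg => exact Option.forall.2 ⟨hopen _ _ _ _, fun _ ↦ hopen _ _ _ _⟩
  case isOpen_pos => exact Option.forall.2 ⟨hopen _ _ _ _, fun _ ↦ hopen _ _ _ _⟩
  case simplyConnected_wall =>
    refine Option.forall.2 ⟨hsc (by norm_num) (by norm_num) (by norm_num) (by norm_num)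
      (hstrip _ _), fun i ↦ hsc (hlt i) ?_ (by norm_num) (by norm_num) (hwindow i)⟩
    linarith [hpos i, hle i]
  case isPathConnected_neg =>
    refine Option.forall.2 ⟨(hsc (by norm_num) (by norm_num) (by norm_num) (by norm_num)
      (hstrip _ _)).isPathConnected, fun i ↦ (hsc (hlt i) ?_ (by norm_num) (by norm_num)
      ((torusRect_mono le_rfl le_rfl le_rfl (by norm_num)).trans (hwindow i))).isPathConnected⟩
    linarith [hpos i, hle i]
  case isPathConnected_pos =>
    refine Option.forall.2 ⟨(hsc (by norm_num) (by norm_num) (by norm_num) (by norm_num)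
      (hstrip _ _)).isPathConnected, fun i ↦ (hsc (hlt i) ?_ (by norm_num) (by norm_num)
      ((torusRect_mono le_rfl le_rfl (by norm_num) le_rfl).trans (hwindow i))).isPathConnected⟩
    linarith [hpos i, hle i]
  case neg_subset_base =>
    exact Option.forall.2 ⟨preimage_mono hstrip_base, fun i ↦ preimage_mono (hwindow_base i)⟩
  case pos_subset_base =>
    exact Option.forall.2 ⟨preimage_mono (torusRect_mono le_rfl (by norm_num) le_rfl le_rfl),
      fun i ↦ preimage_mono (torusRect_mono (hpos i) (hle i) le_rfl (by norm_num))⟩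
  case neg_subset_wall =>
    exact Option.forall.2 ⟨preimage_mono (torusRect_mono le_rfl (by norm_num) le_rfl le_rfl),
      fun i ↦ preimage_mono (torusRect_mono le_rfl le_rfl le_rfl (by norm_num))⟩
  case pos_subset_wall =>
    exact Option.forall.2 ⟨preimage_mono (torusRect_mono (by norm_num) le_rfl le_rfl le_rfl),
      fun i ↦ preimage_mono (torusRect_mono le_rfl le_rfl (by norm_num) le_rfl)⟩
  case disjoint_sides =>
    refine Option.forall.2 ⟨Disjoint.preimage f ?_, fun i ↦ Disjoint.preimage f ?_⟩
    · rw [disjoint_left]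
      rintro _ ⟨⟨s, t⟩, ⟨hs, ht⟩, rfl⟩ ⟨⟨s', t'⟩, ⟨hs', ht'⟩, hp⟩
      simp only [mem_Ioo] at hs hs'
      have := AddCircle.eq_of_coe_eq (Prod.mk.inj hp).1 (by linarith) (by linarith)
      linarith
    · rw [disjoint_left]
      rintro _ ⟨⟨s, t⟩, ⟨hs, ht⟩, rfl⟩ ⟨⟨s', t'⟩, ⟨hs', ht'⟩, hp⟩
      simp only [mem_Ioo] at ht ht'
      have := AddCircle.eq_of_coe_eq (Prod.mk.inj hp).2 (by linarith) (by linarith)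
      linarith
  case inter_subset_sides =>
    have hzero {r s : ℝ} (hr : r ∈ Ioo (0 : ℝ) 1) (hs : s ∈ Ioo (-(1 / 2) : ℝ) (1 / 2))
        (hrs : (r : AddCircle (1 : ℝ)) = s) : s ≠ 0 := by
      rintro rfl
      exact hr.1.ne' (AddCircle.eq_of_coe_eq hrs (by linarith [hr.2]) (by linarith [hr.1]))
    refine Option.forall.2 ⟨?_, fun i ↦ ?_⟩
    · rintro x ⟨⟨⟨s, t⟩, ⟨hs, ht⟩, hx⟩, ⟨⟨s', t'⟩, ⟨hs', ht'⟩, hx'⟩⟩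
      have h0 := hzero hs hs' (Prod.mk.inj (hx.trans hx'.symm)).1
      obtain h | h := h0.lt_or_gt
      · exact .inl ⟨(s', t'), ⟨⟨hs'.1, h⟩, ht'⟩, hx'⟩
      · exact .inr ⟨(s', t'), ⟨⟨h, hs'.2⟩, ht'⟩, hx'⟩
    · rintro x ⟨⟨⟨s, t⟩, ⟨hs, ht⟩, hx⟩, ⟨⟨s', t'⟩, ⟨hs', ht'⟩, hx'⟩⟩
      have h0 := hzero ht ht' (Prod.mk.inj (hx.trans hx'.symm)).2
      obtain h | h := h0.lt_or_gt
      · exact .inl ⟨(s', t'), ⟨hs', ⟨ht'.1, h⟩⟩, hx'⟩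
      · exact .inr ⟨(s', t'), ⟨hs', ⟨h, ht'.2⟩⟩, hx'⟩
  case inter_wall_subset =>
    have hmix (i : Fin m) : torusRect (-(1 / 2)) (1 / 2) 0 1 ∩
        torusRect (i / m) ((i + 1) / m) (-(1 / 2)) (1 / 2) ⊆ torusRect 0 1 0 1 := by
      rintro _ ⟨⟨⟨s, t⟩, ⟨hs, ht⟩, rfl⟩, ⟨⟨s', t'⟩, ⟨hs', ht'⟩, hp⟩⟩
      refine ⟨(s', t), ⟨⟨(hpos i).trans_lt hs'.1, hs'.2.trans_le (hle i)⟩, ht⟩, ?_⟩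
      exact Prod.ext (Prod.mk.inj hp).1 rfl
    rintro (_ | i) (_ | j) hij
    · exact absurd rfl hij
    · exact preimage_mono (hmix j)
    · exact preimage_mono ((inter_comm _ _).subset.trans (hmix i))
    · rintro x ⟨⟨⟨s, t⟩, ⟨hs, ht⟩, hx⟩, ⟨⟨s', t'⟩, ⟨hs', ht'⟩, hx'⟩⟩
      have hs1 := hs
      have hs2 := hs'
      simp only [mem_Ioo] at hs1 hs2
      have h1 := AddCircle.eq_of_coe_eq (Prod.mk.inj (hx.trans hx'.symm)).1
        (by linarith [hle i, hpos j]) (by linarith [hle j, hpos i])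
      exact absurd (congrArg some (hsep hs (h1 ▸ Ioo_subset_Ico_self hs')).1) hij
  case cover =>
    intro x
    obtain ⟨s, hs, hs'⟩ := AddCircle.exists_coe_eq_of_mem_Ico (f x).1
    obtain ⟨t, ht, ht'⟩ := AddCircle.exists_coe_eq_of_mem_Ico (f x).2
    have hfx : f x = ((s : AddCircle (1 : ℝ)), (t : AddCircle (1 : ℝ))) :=
      Prod.ext hs'.symm ht'.symm
    simp only [mem_preimage, hfx]
    obtain rfl | ht0 := ht.1.eq_or_lt
    · right
      have hms : 0 ≤ m * s := mul_nonneg hm0.le hs.1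
      have hfloor : ⌊m * s⌋₊ < m := by
        rw [Nat.floor_lt hms]
        exact mul_lt_of_lt_one_right hm0 hs.2
      refine ⟨some ⟨⌊m * s⌋₊, hfloor⟩, mem_torusRect ⟨?_, ?_⟩ (by norm_num)⟩
      · refine lt_of_le_of_ne ?_ fun heq ↦ ?_
        · rw [div_le_iff₀ hm0, mul_comm s]
          exact Nat.floor_le hms
        · refine (hrange (f x)).1 ⟨x, rfl⟩ ⟨⌊m * s⌋₊, hfloor⟩ ?_
          rw [hfx, heq]
      · rw [lt_div_iff₀ hm0, mul_comm s]
        exact Nat.lt_floor_add_one _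
    · obtain rfl | hs0 := hs.1.eq_or_lt
      · exact .inr ⟨none, mem_torusRect (by norm_num) ⟨ht0, ht.2⟩⟩
      · exact .inl (mem_torusRect ⟨hs0, hs.2⟩ ⟨ht0, ht.2⟩)

end Torus

section Straightening

theorem AddCircle.exists_continuousMap_eqOn {Y : Set (AddCircle (1 : ℝ))} (hY : Y.Finite)
    (c : AddCircle (1 : ℝ) → AddCircle (1 : ℝ)) :
    ∃ g : C(AddCircle (1 : ℝ), AddCircle (1 : ℝ)), EqOn g c Y := by
  choose r _ hr using fun y ↦ AddCircle.exists_coe_eq_of_mem_Ico (c y)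
  have := hY.to_subtype
  obtain ⟨g, hg⟩ := ContinuousMap.exists_restrict_eq hY.isClosed
    (⟨fun y ↦ r y, continuous_of_discreteTopology⟩ : C(Y, ℝ))
  refine ⟨⟨fun y ↦ ((g y : ℝ) : AddCircle (1 : ℝ)),
    Continuous.comp (AddCircle.continuous_mk' (1 : ℝ)) g.continuous⟩, fun y hy ↦ ?_⟩
  have h : g y = r y := DFunLike.congr_fun hg ⟨y, hy⟩
  change ((g y : ℝ) : AddCircle (1 : ℝ)) = c y
  rw [h, hr]

/-- The homeomorphism `(x, y) ↦ (x, y + g x)` of the product of a space with a topological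
group. -/
def Homeomorph.shearSnd {X G : Type*} [TopologicalSpace X] [AddGroup G] [TopologicalSpace G]
    [IsTopologicalAddGroup G] (g : C(X, G)) : X × G ≃ₜ X × G where
  toFun p := (p.1, p.2 + g p.1)
  invFun p := (p.1, p.2 - g p.1)
  left_inv p := by simp
  right_inv p := by simp
  continuous_toFun := by fun_prop
  continuous_invFun := by fun_prop

/-- Points of the torus with distinct first coordinates can be moved to points with prescribed
second coordinates without changing their first coordinates. -/
theorem exists_homeomorph_snd_eq {ι : Type*} [Finite ι]
    {P : ι → AddCircle (1 : ℝ) × AddCircle (1 : ℝ)} (hP : Function.Injective fun i ↦ (P i).1)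
    (d : ι → AddCircle (1 : ℝ)) :
    ∃ e : AddCircle (1 : ℝ) × AddCircle (1 : ℝ) ≃ₜ AddCircle (1 : ℝ) × AddCircle (1 : ℝ),
      ∀ i, e (P i) = ((P i).1, d i) := by
  obtain ⟨g, hg⟩ := AddCircle.exists_continuousMap_eqOn (finite_range fun i ↦ (P i).1)
    (Function.extend (fun i ↦ (P i).1) (fun i ↦ d i - (P i).2) 0)
  refine ⟨Homeomorph.shearSnd g, fun i ↦ ?_⟩
  have h := hg (mem_range_self i)
  rw [hP.extend_apply] at h
  change ((P i).1, (P i).2 + g (P i).1) = _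
  rw [h, add_sub_cancel]

theorem exists_homeomorph_fst_eq {ι : Type*} [Finite ι]
    {P : ι → AddCircle (1 : ℝ) × AddCircle (1 : ℝ)} (hP : Function.Injective fun i ↦ (P i).2)
    (d : ι → AddCircle (1 : ℝ)) :
    ∃ e : AddCircle (1 : ℝ) × AddCircle (1 : ℝ) ≃ₜ AddCircle (1 : ℝ) × AddCircle (1 : ℝ),
      ∀ i, e (P i) = (d i, (P i).2) := by
  obtain ⟨e, he⟩ := exists_homeomorph_snd_eq (P := fun i ↦ (P i).swap) hP d
  exact ⟨(Homeomorph.prodComm _ _).trans (e.trans (Homeomorph.prodComm _ _)),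
    fun i ↦ congrArg Prod.swap (he i)⟩

theorem AddCircle.countable_setOf_coe_mul_eq {d : ℝ} (hd : d ≠ 0) (u : AddCircle (1 : ℝ)) :
    {ε : ℝ | ((ε * d : ℝ) : AddCircle (1 : ℝ)) = u}.Countable := by
  obtain ⟨s, -, rfl⟩ := AddCircle.exists_coe_eq_of_mem_Ico u
  refine (countable_range fun n : ℤ ↦ (s + n) / d).mono fun ε hε ↦ ?_
  rw [mem_ofPred_eq, ← sub_eq_zero, ← AddCircle.coe_sub, AddCircle.coe_eq_zero_iff] at hε
  obtain ⟨n, hn⟩ := hε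
  rw [zsmul_eq_mul, mul_one] at hn
  exact ⟨n, by simp [hn, hd]⟩

/-- Distinct points of the torus can be moved to points with distinct second coordinates. -/
theorem exists_homeomorph_injective_snd {ι : Type*} [Finite ι]
    {P : ι → AddCircle (1 : ℝ) × AddCircle (1 : ℝ)} (hP : Function.Injective P) :
    ∃ e : AddCircle (1 : ℝ) × AddCircle (1 : ℝ) ≃ₜ AddCircle (1 : ℝ) × AddCircle (1 : ℝ),
      Function.Injective fun i ↦ (e (P i)).2 := by
  choose r _ hr using AddCircle.exists_coe_eq_of_mem_Ico
  have hbad : (⋃ (i : ι) (j : ι) (_ : r (P i).1 - r (P j).1 ≠ 0),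
      {ε : ℝ | ((ε * (r (P i).1 - r (P j).1) : ℝ) : AddCircle (1 : ℝ)) =
        (P j).2 - (P i).2}).Countable :=
    countable_iUnion fun _ ↦ countable_iUnion fun _ ↦ countable_iUnion fun h ↦
      AddCircle.countable_setOf_coe_mul_eq h _
  obtain ⟨ε, hε⟩ := (hbad.dense_compl ℝ).nonempty
  obtain ⟨g, hg⟩ := AddCircle.exists_continuousMap_eqOn (finite_range fun i ↦ (P i).1)
    fun x ↦ ((ε * r x : ℝ) : AddCircle (1 : ℝ))
  refine ⟨Homeomorph.shearSnd g, fun i j (hij : (P i).2 + g (P i).1 = (P j).2 + g (P j).1) ↦ ?_⟩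
  have hi : g (P i).1 = ((ε * r (P i).1 : ℝ) : AddCircle (1 : ℝ)) := hg (mem_range_self i)
  have hj : g (P j).1 = ((ε * r (P j).1 : ℝ) : AddCircle (1 : ℝ)) := hg (mem_range_self j)
  by_cases h : r (P i).1 - r (P j).1 = 0
  · have h1 : (P i).1 = (P j).1 := by rw [← hr (P i).1, sub_eq_zero.1 h, hr]
    rw [h1, add_left_inj] at hij
    exact hP (Prod.ext h1 hij)
  · refine (hε ?_).elim
    simp only [mem_iUnion]
    refine ⟨i, j, h, ?_⟩
    rw [mem_ofPred_eq, mul_sub, AddCircle.coe_sub, ← hi, ← hj, sub_eq_sub_iff_add_eq_add,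
      add_comm, hij]

/-- The homeomorphism group of the torus acts transitively on tuples of `m` distinct points; here
the target consists of equally spaced points on a horizontal circle. -/
theorem exists_homeomorph_equally_spaced {m : ℕ}
    {P : Fin m → AddCircle (1 : ℝ) × AddCircle (1 : ℝ)} (hP : Function.Injective P) :
    ∃ e : AddCircle (1 : ℝ) × AddCircle (1 : ℝ) ≃ₜ AddCircle (1 : ℝ) × AddCircle (1 : ℝ),
      ∀ i, e (P i) = (((i / m : ℝ) : AddCircle (1 : ℝ)), ((0 : ℝ) : AddCircle (1 : ℝ))) := by
  have hspaced : Function.Injective fun i : Fin m ↦ ((i / m : ℝ) : AddCircle (1 : ℝ)) := by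
    intro i j hij
    have hm : (0 : ℝ) < m := by exact_mod_cast i.pos
    have hpos (k : Fin m) : (0 : ℝ) ≤ k / m := by positivity
    have hlt (k : Fin m) : (k / m : ℝ) < 1 := by
      rw [div_lt_one hm]
      exact_mod_cast k.isLt
    have h := AddCircle.eq_of_coe_eq hij (by linarith [hlt i, hpos j]) (by linarith [hlt j, hpos i])
    rw [div_left_inj' hm.ne', Nat.cast_inj] at h
    exact Fin.ext h
  obtain ⟨e₁, h₁⟩ := exists_homeomorph_injective_snd hP
  obtain ⟨e₂, h₂⟩ := exists_homeomorph_fst_eq h₁ fun i ↦ ((i / m : ℝ) : AddCircle (1 : ℝ))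
  obtain ⟨e₃, h₃⟩ := exists_homeomorph_snd_eq (P := fun i ↦ e₂ (e₁ (P i)))
    (by simpa only [h₂] using hspaced) fun _ ↦ ((0 : ℝ) : AddCircle (1 : ℝ))
  exact ⟨e₁.trans (e₂.trans e₃), fun i ↦ (h₃ i).trans (by rw [h₂])⟩

end Straightening

end FreeFundamentalGroup

theorem punctured_torus_pi1_free (m : ℕ) (hm : 1 ≤ m)
    (S : Set ((AddCircle (1 : ℝ)) × (AddCircle (1 : ℝ))))
    (hS : S.Finite) (hcard : hS.toFinset.card = m)
    (x : ↥(Sᶜ)) :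
    Nonempty (FundamentalGroup (↥(Sᶜ)) x ≃* FreeGroup (Fin (m + 1))) := by
  let τ : Fin m ≃ S := (hS.toFinset.equivFinOfCardEq hcard).symm.trans
    (Equiv.subtypeEquivRight fun _ ↦ hS.mem_toFinset)
  obtain ⟨e, he⟩ := exists_homeomorph_equally_spaced
    (P := fun i ↦ (τ i : AddCircle (1 : ℝ) × AddCircle (1 : ℝ)))
    (Subtype.val_injective.comp τ.injective)
  obtain ⟨U, V, N, P, h⟩ := exists_isCutSystem_of_punctures hm
    (f := fun p : ↥(Sᶜ) ↦ e p) (e.isEmbedding.comp Topology.IsEmbedding.subtypeVal) fun p ↦ by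
      simp only [← he]
      obtain ⟨q, rfl⟩ := e.surjective p
      rw [τ.forall_congr_right (q := fun s : S ↦ e q ≠ e s)]
      simp only [Set.mem_range, Subtype.exists, ne_eq, Subtype.forall, e.injective.eq_iff,
        exists_prop, exists_eq_right, Set.mem_compl_iff]
      exact ⟨fun h s hs hq ↦ h (hq ▸ hs), fun h hq ↦ h q hq rfl⟩
  obtain ⟨b, hb⟩ := h.simplyConnected_base.nonempty
  obtain ⟨φ⟩ := h.nonempty_fundamentalGroup_mulEquiv hb
  have := h.pathConnectedSpace
  exact ⟨(FundamentalGroup.fundamentalGroupMulEquivOfPathConnected x b).trans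
    (φ.trans (FreeGroup.freeGroupCongr (finSuccEquiv m).symm))⟩
end

section
/- Let T = (AddCircle (1:ℝ)) × (AddCircle (1:ℝ)) be the 2-dimensional torus, let S ⊆ T be a finite set of cardinality m with m ≥ 1, let X = T \ S (with the subspace topology), let k ≥ 1, and let F_k(X) = {f : Fin k → X // Function.Injective f} be the ordered configuration space of k points in X (with the subspace topology induced from the product topology on Fin k → X). Then for every basepoint y ∈ F_k(X), the center of the fundamental group FundamentalGroup (F_k(X)) y is trivial. -/
open scoped unitInterval
open Path.Homotopic

instance : ContractibleSpace I := (convex_Icc (0:ℝ) 1).contractibleSpace ⟨0, by simp⟩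

theorem Path.diag_homotopic {X : Type*} [TopologicalSpace X] {a b d : X}
    (M : I × I → X) (hM : Continuous M) (p : Path a b) (q : Path b d) (r : Path a d)
    (hp : ∀ t, p t = M (t, 0)) (hq : ∀ t, q t = M (1, t))
    (hr : ∀ t, r t = M (t, t)) :
    (p.trans q).Homotopic r := by
  obtain rfl : M (0, 0) = a := by rw [← hp]; simp
  obtain rfl : M (1, 0) = b := by rw [← hp]; simp
  obtain rfl : M (1, 1) = d := by rw [← hq]; simp
  let p' : Path ((0, 0) : I × I) (1, 0) := ⟨⟨fun t => (t, 0), by fun_prop⟩, rfl, rfl⟩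
  let q' : Path ((1, 0) : I × I) (1, 1) := ⟨⟨fun t => (1, t), by fun_prop⟩, rfl, rfl⟩
  let r' : Path ((0, 0) : I × I) (1, 1) := ⟨⟨fun t => (t, t), by fun_prop⟩, rfl, rfl⟩
  have hp' : p = p'.map hM := by ext t; exact hp t
  have hq' : q = q'.map hM := by ext t; exact hq t
  have hr' : r = r'.map hM := by ext t; exact hr t
  rw [hp', hq', hr', ← Path.map_trans]
  exact (SimplyConnectedSpace.paths_homotopic (p'.trans q') r').map ⟨M, hM⟩

theorem Path.square_homotopic {X : Type*} [TopologicalSpace X] {a b c d : X}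
    (M : I × I → X) (hM : Continuous M) (p : Path a b) (q : Path b d) (r : Path a c) (s : Path c d)
    (hp : ∀ t, p t = M (t, 0)) (hq : ∀ t, q t = M (1, t))
    (hr : ∀ t, r t = M (0, t)) (hs : ∀ t, s t = M (t, 1)) :
    (p.trans q).Homotopic (r.trans s) := by
  obtain rfl : M (0, 0) = a := by rw [← hp]; simp
  obtain rfl : M (1, 1) = d := by rw [← hq]; simp
  let r' : Path (M (0, 0)) (M (1, 1)) := ⟨⟨fun t => M (t, t), by fun_prop⟩, rfl, rfl⟩
  refine (Path.diag_homotopic M hM p q r' hp hq fun _ => rfl).trans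
    (Path.diag_homotopic (fun x => M (x.2, x.1)) (by fun_prop) r s r' hr hs fun _ => rfl).symm

theorem FreeGroup.center_eq_bot (α : Type*) [Nontrivial α] :
    Subgroup.center (FreeGroup α) = ⊥ := by
  classical
  rw [eq_bot_iff]
  intro z hz
  rw [Subgroup.mem_center_iff] at hz
  rw [Subgroup.mem_bot]
  by_contra hne
  have hw : z.toWord ≠ [] := by simpa using hne
  obtain ⟨⟨i, ε⟩, w, hzw⟩ := List.exists_cons_of_ne_nil hw
  obtain ⟨j, hj⟩ := exists_ne i
  have h1 : (FreeGroup.of j * z).toWord = (j, true) :: z.toWord := by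
    have := FreeGroup.reduce_toWord z
    rw [FreeGroup.toWord_mul, FreeGroup.toWord_of, List.singleton_append, FreeGroup.reduce.cons,
      this, hzw]
    simp [hj]
  have h2 := FreeGroup.toWord_mul_sublist z (FreeGroup.of j)
  rw [← hz, h1, FreeGroup.toWord_of] at h2
  have h3 := h2.eq_of_length (by simp)
  rw [hzw] at h3
  simp [hj] at h3

theorem MulEquiv.center_eq_bot {G H : Type*} [Group G] [Group H] (e : G ≃* H)
    (h : Subgroup.center G = ⊥) : Subgroup.center H = ⊥ := by
  have : Subsingleton (Subgroup.center G) := by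
    rw [h]
    infer_instance
  have := (Subgroup.centerCongr e).symm.toEquiv.subsingleton
  exact (Subgroup.center H).eq_bot_of_subsingleton

def HasTrivialCenterAt {X : Type*} [TopologicalSpace X] (x : X) : Prop :=
  ∀ γ : Path.Homotopic.Quotient x x,
    (∀ δ : Path.Homotopic.Quotient x x, γ.trans δ = δ.trans γ) → γ = .refl x

theorem center_fundamentalGroup_eq_bot_iff {X : Type*} [TopologicalSpace X] (x : X) :
    Subgroup.center (FundamentalGroup X x) = ⊥ ↔ HasTrivialCenterAt x := by
  rw [eq_bot_iff]
  constructor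
  · intro h γ hγ
    exact h (Subgroup.mem_center_iff.2 fun δ => hγ δ)
  · intro h γ hγ
    exact h γ fun δ => Subgroup.mem_center_iff.1 hγ δ

def HasIsotopyLifting {E B : Type*} [TopologicalSpace E] [TopologicalSpace B] (p : E → B) : Prop :=
  ∀ β : C(I × I, B), ∃ h g : I × I → E → E,
    Continuous (fun x : (I × I) × E => h x.1 x.2) ∧
    Continuous (fun x : (I × I) × E => g x.1 x.2) ∧
    (∀ c e, h c (g c e) = e) ∧ (∀ s e, h (s, 0) e = e) ∧
    (∀ s, (∀ t, β (s, t) = β (s, 0)) → ∀ t e, h (s, t) e = e) ∧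
    (∀ s, (∀ t, β (s, t) = β (s, 0)) → ∀ t e, g (s, t) e = e) ∧
    (∀ s e, g (s, 0) e = e) ∧
    (∀ s t e, p e = β (s, 0) → p (h (s, t) e) = β (s, t)) ∧
    (∀ s t e, p e = β (s, t) → p (g (s, t) e) = β (s, 0))

section Fibration

variable {E B : Type*} [TopologicalSpace E] [TopologicalSpace B] {p : E → B}

theorem HasIsotopyLifting.exists_path_lift (hl : HasIsotopyLifting p) {e : E} {b : B}
    (γ : Path (p e) b) : ∃ (e' : E) (δ : Path e e'), ∀ t, p (δ t) = γ t := by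
  obtain ⟨h, g, hc, -, -, h0, -, -, -, hp, -⟩ := hl ⟨fun x => γ x.2, by fun_prop⟩
  refine ⟨h (0, 1) e, ⟨⟨fun t => h (0, t) e, ?_⟩, h0 0 e, rfl⟩, fun t => ?_⟩
  · exact hc.comp (by fun_prop : Continuous fun t : I => (((0 : I), t), e))
  · exact hp 0 t e (by simp)

theorem HasIsotopyLifting.pathConnectedSpace [PathConnectedSpace B] (hl : HasIsotopyLifting p)
    (e₀ : E) [PathConnectedSpace {e // p e = p e₀}] : PathConnectedSpace E := by
  have key : ∀ e, Joined e e₀ := fun e => by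
    obtain ⟨e', δ, hδ⟩ := hl.exists_path_lift (PathConnectedSpace.somePath (p e) (p e₀))
    have he' : p e' = p e₀ := by simpa using hδ 1
    have h2 : Joined (⟨e', he'⟩ : {e // p e = p e₀}) ⟨e₀, rfl⟩ := PathConnectedSpace.joined _ _
    exact Joined.trans ⟨δ⟩ ⟨h2.somePath.map continuous_subtype_val⟩
  exact ⟨⟨e₀⟩, fun x y => (key x).trans (key y).symm⟩

theorem HasIsotopyLifting.exists_path_fiber (hl : HasIsotopyLifting p) (hp : Continuous p) {e₀ : E}
    (γ : Path e₀ e₀) (hγ : (γ.map hp).Homotopic (Path.refl _)) :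
    ∃ w : Path (⟨e₀, rfl⟩ : {e // p e = p e₀}) ⟨e₀, rfl⟩,
      γ.Homotopic (w.map continuous_subtype_val) := by
  obtain ⟨K⟩ := hγ.symm
  obtain ⟨h, g, hc, gc, hg, h0, hst, gst, g0, hph, hpg⟩ := hl ⟨fun x => K (x.2, x.1), by fun_prop⟩
  simp only [ContinuousMap.coe_mk] at hst gst hph hpg
  have c0 : ∀ t, K (t, 0) = K (0, 0) := by simp
  have c1 : ∀ t, K (t, 1) = K (0, 1) := by simp
  have hK : ∀ s, K (0, s) = p e₀ := by simp
  have hK1 : ∀ s, K (1, s) = p (γ s) := by simp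
  have hm : ∀ s, p (g (s, 1) (γ s)) = p e₀ := fun s => by
    rw [hpg s 1 _ (hK1 s).symm, hK]
  let w : Path (⟨e₀, rfl⟩ : {e // p e = p e₀}) ⟨e₀, rfl⟩ :=
    { toFun := fun s => ⟨g (s, 1) (γ s), hm s⟩
      continuous_toFun := Continuous.subtype_mk
        (gc.comp (by fun_prop : Continuous fun s : I => ((s, (1 : I)), γ s))) _
      source' := by
        apply Subtype.ext
        simp [gst 0 c0 1]
      target' := by
        apply Subtype.ext
        simp [gst 1 c1 1] }
  refine ⟨w, ⟨Path.Homotopy.symm ⟨⟨⟨fun x => h (x.2, x.1) (g (x.2, 1) (γ x.2)), ?_⟩, ?_, ?_⟩, ?_⟩⟩⟩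
  · exact hc.comp (Continuous.prodMk (by fun_prop)
      (gc.comp (by fun_prop : Continuous fun x : I × I => ((x.2, (1 : I)), γ x.2))))
  · intro s
    simp [h0, w]
  · intro s
    simp [hg]
  · rintro t s (rfl | rfl)
    · simp [gst 0 c0, hst 0 c0]
    · simp [gst 1 c1, hst 1 c1]

theorem HasIsotopyLifting.trans_comm_of_map_eq_refl (hl : HasIsotopyLifting p) (hp : Continuous p)
    {e₀ : E} (w u : Path (⟨e₀, rfl⟩ : {e // p e = p e₀}) ⟨e₀, rfl⟩)
    (hw : (w.map continuous_subtype_val).Homotopic (Path.refl e₀)) :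
    (w.trans u).Homotopic (u.trans w) := by
  obtain ⟨H⟩ := hw.symm
  obtain ⟨h, g, hc, gc, hg, h0, hst, gst, g0, hph, hpg⟩ :=
    hl ⟨fun x => p (H (x.2, x.1)), by fun_prop⟩
  simp only [ContinuousMap.coe_mk] at hst gst hph hpg
  have c0 : ∀ t, p (H (t, 0)) = p (H (0, 0)) := by simp
  have c1 : ∀ t, p (H (t, 1)) = p (H (0, 1)) := by simp
  have hb : ∀ s, p (H (0, s)) = p e₀ := by simp
  have hb1 : ∀ s, p (H (1, s)) = p e₀ := fun s => by simpa using (w s).2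
  let x₀ : {e // p e = p e₀} := ⟨e₀, rfl⟩
  have hF : ∀ s (x : {e // p e = p e₀}), p (g (s, 1) x.1) = p e₀ := fun s x => by
    rw [hpg s 1 x.1 (by rw [x.2, hb1]), hb]
  let G : I × {e // p e = p e₀} → {e // p e = p e₀} := fun x => ⟨g (x.1, 1) x.2.1, hF x.1 x.2⟩
  have hG : Continuous G := Continuous.subtype_mk (gc.comp
    (by fun_prop : Continuous fun x : I × {e // p e = p e₀} => ((x.1, (1 : I)), x.2.1))) _
  have G0 : ∀ x, G (0, x) = x := fun x => Subtype.ext (gst 0 c0 1 _)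
  have G1 : ∀ x, G (1, x) = x := fun x => Subtype.ext (gst 1 c1 1 _)
  let v : Path x₀ x₀ := ⟨⟨fun s => G (s, x₀), by fun_prop⟩, G0 _, G1 _⟩
  let w' : Path x₀ x₀ := ⟨⟨fun s => G (s, w s), by fun_prop⟩, by simp [G0, x₀], by simp [G1, x₀]⟩
  have hv : ∀ u : Path x₀ x₀, (v.trans u).Homotopic (u.trans v) := fun u =>
    Path.square_homotopic (fun x => G (x.1, u x.2)) (by fun_prop) v u u v
      (by intro t; simp [v]) (by intro t; simp [G1]) (by intro t; simp [G0]) (by intro t; simp [v])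
  have hvw : (v.trans w).Homotopic w' :=
    Path.diag_homotopic (fun x => G (x.1, w x.2)) (by fun_prop) v w w'
      (by intro t; simp [v, x₀]) (by intro t; simp [G1]) (by intro t; simp [w'])
  have hw' : w'.Homotopic (Path.refl x₀) := by
    refine ⟨Path.Homotopy.symm ⟨⟨⟨fun x => ⟨g (x.2, x.1) (H x), ?_⟩, ?_⟩, ?_, ?_⟩, ?_⟩⟩
    · rw [hpg x.2 x.1 _ rfl, hb]
    · exact Continuous.subtype_mk (gc.comp
        (by fun_prop : Continuous fun x : I × I => ((x.2, x.1), H x))) _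
    · intro s
      simp [g0, x₀]
    · intro s
      apply Subtype.ext
      simp [w', G]
    · rintro t s (rfl | rfl) <;> apply Subtype.ext
      · simp [gst 0 c0, x₀]
      · simp [gst 1 c1, x₀]
  have hv' := Path.Homotopic.Quotient.eq.2 (hv u)
  have e1 := Path.Homotopic.Quotient.eq.2 (hvw.trans hw')
  rw [← Path.Homotopic.Quotient.eq]
  simp only [Path.Homotopic.Quotient.mk_trans, Path.Homotopic.Quotient.mk_refl] at *
  generalize Path.Homotopic.Quotient.mk v = V at *
  generalize Path.Homotopic.Quotient.mk w = W at *
  generalize Path.Homotopic.Quotient.mk u = U at *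
  have e2 : W = V.symm := by
    calc W = (V.symm.trans V).trans W := by simp
      _ = V.symm := by rw [Path.Homotopic.Quotient.trans_assoc, e1, Path.Homotopic.Quotient.trans_refl]
  rw [e2]
  calc V.symm.trans U = V.symm.trans ((U.trans V).trans V.symm) := by simp
    _ = U.trans V.symm := by rw [← hv', Path.Homotopic.Quotient.trans_assoc, ← Path.Homotopic.Quotient.trans_assoc]; simp

theorem HasIsotopyLifting.hasTrivialCenterAt (hl : HasIsotopyLifting p) (hp : Continuous p)
    (e₀ : E) [PathConnectedSpace {e // p e = p e₀}] (hB : HasTrivialCenterAt (p e₀))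
    (hF : HasTrivialCenterAt (⟨e₀, rfl⟩ : {e // p e = p e₀})) : HasTrivialCenterAt e₀ := by
  intro γ hγ
  induction γ using Path.Homotopic.Quotient.ind with | mk γ =>
  have h1 : (γ.map hp).Homotopic (Path.refl _) := by
    refine Path.Homotopic.Quotient.eq.1 (hB (.mk _) fun δ => ?_)
    induction δ using Path.Homotopic.Quotient.ind with | mk δ =>
    obtain ⟨e', δ', hδ'⟩ := hl.exists_path_lift δ
    have he' : p e' = p e₀ := by simpa using hδ' 1
    let τ : Path (⟨e', he'⟩ : {e // p e = p e₀}) ⟨e₀, rfl⟩ := PathConnectedSpace.somePath _ _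
    let η := δ'.trans (τ.map continuous_subtype_val)
    have hη : (η.map hp).Homotopic δ := by
      have : η.map hp = (δ.trans (Path.refl _)) := by
        ext t
        simp only [η, Path.map_coe, Function.comp, Path.trans_apply]
        split_ifs
        · exact hδ' _
        · exact (τ _).2
      rw [this]
      exact Path.Homotopic.trans_refl δ
    have := hγ (.mk η)
    rw [← Path.Homotopic.Quotient.eq.2 hη, ← Path.Homotopic.Quotient.mk_trans, ← Path.Homotopic.Quotient.mk_trans, ← Path.map_trans,
      ← Path.map_trans, Path.Homotopic.Quotient.eq]
    rw [← Path.Homotopic.Quotient.mk_trans, ← Path.Homotopic.Quotient.mk_trans, Path.Homotopic.Quotient.eq] at this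
    exact this.map ⟨p, hp⟩
  obtain ⟨w, hw⟩ := hl.exists_path_fiber hp γ h1
  have hcomm : ∀ u : Path.Homotopic.Quotient (⟨e₀, rfl⟩ : {e // p e = p e₀}) ⟨e₀, rfl⟩,
      Path.Homotopic.Quotient.trans (.mk w) u = u.trans (.mk w) := by
    intro u
    induction u using Path.Homotopic.Quotient.ind with | mk u =>
    have hq : (((w.trans u).trans (u.trans w).symm).map continuous_subtype_val).Homotopic
        (Path.refl e₀) := by
      have h2 := hγ (.mk (u.map continuous_subtype_val))
      rw [Path.Homotopic.Quotient.eq.2 hw, ← Path.Homotopic.Quotient.mk_trans,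
        ← Path.Homotopic.Quotient.mk_trans, Path.Homotopic.Quotient.eq] at h2
      have h3 : ((w.trans u).map continuous_subtype_val).Homotopic
          ((u.trans w).map continuous_subtype_val) := by
        rw [Path.map_trans, Path.map_trans]
        exact h2
      rw [Path.map_trans, ← Path.map_symm]
      exact (h3.hcomp (.refl _)).trans (Path.Homotopic.trans_symm _)
    have hq2 : Path.Homotopic.Quotient.mk ((w.trans u).trans (u.trans w).symm) = .refl _ := by
      apply hF
      intro u'
      induction u' using Path.Homotopic.Quotient.ind with | mk u' =>
      rw [← Path.Homotopic.Quotient.mk_trans, ← Path.Homotopic.Quotient.mk_trans,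
        Path.Homotopic.Quotient.eq]
      exact hl.trans_comm_of_map_eq_refl hp _ u' hq
    simp only [Path.Homotopic.Quotient.mk_trans, Path.Homotopic.Quotient.mk_symm] at hq2
    generalize Path.Homotopic.Quotient.mk w = W at *
    generalize Path.Homotopic.Quotient.mk u = U at *
    calc W.trans U = ((W.trans U).trans (U.trans W).symm).trans (U.trans W) := by
          rw [Path.Homotopic.Quotient.trans_assoc, Path.Homotopic.Quotient.symm_trans,
            Path.Homotopic.Quotient.trans_refl]
      _ = _ := by rw [hq2, Path.Homotopic.Quotient.refl_trans]
  have hw1 := hF _ hcomm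
  rw [Path.Homotopic.Quotient.eq.2 hw, ← Path.Homotopic.Quotient.mk_refl, Path.Homotopic.Quotient.eq]
  exact (Path.Homotopic.Quotient.eq.1 hw1).map ⟨_, continuous_subtype_val⟩

end Fibration

theorem Path.Homotopic.Quotient.trans_left_cancel {X : Type*} [TopologicalSpace X] {x y z : X}
    {p : Path.Homotopic.Quotient x y} {q r : Path.Homotopic.Quotient y z}
    (h : p.trans q = p.trans r) : q = r := by
  simpa [← Path.Homotopic.Quotient.trans_assoc] using congrArg p.symm.trans h

theorem Path.Homotopic.Quotient.trans_right_cancel {X : Type*} [TopologicalSpace X] {x y z : X}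
    {p q : Path.Homotopic.Quotient x y} {r : Path.Homotopic.Quotient y z}
    (h : p.trans r = q.trans r) : p = q := by
  simpa [Path.Homotopic.Quotient.trans_assoc] using congrArg (fun w => w.trans r.symm) h

/-- A cover by charts, each contracted in the ambient space to the base point `x₀`, whose pairwise
intersections lie in a distinguished chart `o`; the chart `i` is glued to `o` along a locally
constant `G`-valued label. -/
structure ChartSystem (X : Type*) [TopologicalSpace X] (x₀ : X) (ι G : Type*) [Group G]
    [TopologicalSpace G] where
  chart : ι → Set X
  isOpen_chart : ∀ i, IsOpen (chart i)
  cover : ∀ x, ∃ i, x ∈ chart i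
  o : ι
  inter_subset : ∀ i j, i ≠ j → chart i ∩ chart j ⊆ chart o
  label : ι → X → G
  label_o : ∀ x, label o x = 1
  continuousOn_label : ∀ i, ContinuousOn (label i) (chart i ∩ chart o)
  contr : ∀ i, C(I × chart i, X)
  contr_zero : ∀ i x, contr i (0, x) = x₀
  contr_one : ∀ i x, contr i (1, x) = x

namespace ChartSystem

variable {X : Type*} [TopologicalSpace X] {x₀ : X} {ι G : Type*} [Group G]
  [TopologicalSpace G] (P : ChartSystem X x₀ ι G)

def path {i : ι} {x : X} (hx : x ∈ P.chart i) : Path x₀ x where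
  toFun t := P.contr i (t, ⟨x, hx⟩)
  continuous_toFun := by fun_prop
  source' := P.contr_zero _ _
  target' := P.contr_one _ _

theorem path_trans {i : ι} {x y : X} (hx : x ∈ P.chart i) (hy : y ∈ P.chart i) (γ : Path x y)
    (hγ : ∀ t, γ t ∈ P.chart i) :
    (Path.Homotopic.Quotient.mk (P.path hx)).trans (.mk γ) = .mk (P.path hy) := by
  have h := Path.square_homotopic (fun z : I × I => P.contr i (z.1, ⟨γ z.2, hγ z.2⟩))
    (by fun_prop) (P.path hx) γ (Path.refl x₀) (P.path hy)
    (fun t => by simp [path]) (fun t => by simp [P.contr_one])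
    (fun t => by simp [P.contr_zero]) (fun t => by simp [path])
  rw [← Path.Homotopic.Quotient.mk_trans, Path.Homotopic.Quotient.eq.2 h]
  simp

noncomputable def transition {i : ι} {x : X} (hi : x ∈ P.chart i) (ho : x ∈ P.chart P.o) :
    Path.Homotopic.Quotient x₀ x₀ :=
  (Path.Homotopic.Quotient.mk (P.path hi)).trans (Path.Homotopic.Quotient.mk (P.path ho)).symm

theorem transition_trans {i : ι} {x : X} (hi : x ∈ P.chart i) (ho : x ∈ P.chart P.o) :
    (P.transition hi ho).trans (.mk (P.path ho)) = .mk (P.path hi) := by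
  rw [transition, Path.Homotopic.Quotient.trans_assoc]
  simp

theorem transition_eq_refl {i : ι} {x : X} {hi : x ∈ P.chart i} {ho : x ∈ P.chart P.o}
    (h : Path.Homotopic.Quotient.mk (P.path hi) = .mk (P.path ho)) :
    P.transition hi ho = .refl x₀ := by
  rw [transition, h]
  simp

theorem transition_eq_of_joinedIn {i : ι} {x y : X} (h : JoinedIn (P.chart i ∩ P.chart P.o) x y)
    (hi : x ∈ P.chart i) (ho : x ∈ P.chart P.o) (hi' : y ∈ P.chart i) (ho' : y ∈ P.chart P.o) :
    P.transition hi ho = P.transition hi' ho' := by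
  obtain ⟨γ, hγ⟩ := h
  refine Path.Homotopic.Quotient.trans_right_cancel (r := .mk (P.path ho')) ?_
  rw [transition, transition, ← P.path_trans hi hi' γ fun t => (hγ t).1,
    ← P.path_trans ho ho' γ fun t => (hγ t).2]
  simp only [Path.Homotopic.Quotient.trans_assoc]
  rw [← Path.Homotopic.Quotient.trans_assoc (Path.Homotopic.Quotient.symm _)]
  simp

end ChartSystem

/-- A chart system together with a homomorphism from the label group to the fundamental group. -/
structure ChartPresentation (X : Type*) [TopologicalSpace X] (x₀ : X) (ι G : Type*) [Group G]
    [TopologicalSpace G] extends ChartSystem X x₀ ι G where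
  hom : G →* FundamentalGroup X x₀

namespace ChartPresentation

variable {X : Type*} [TopologicalSpace X] {x₀ : X} {ι G : Type*} [Group G]
  [TopologicalSpace G] (P : ChartPresentation X x₀ ι G)

noncomputable def loop (g : G) : Path.Homotopic.Quotient x₀ x₀ := P.hom g

theorem loop_one : P.loop 1 = .refl x₀ := map_one P.hom

theorem loop_mul (g h : G) : P.loop (g * h) = (P.loop h).trans (P.loop g) := map_mul P.hom g h

def IsCompatible : Prop := ∀ i x (hi : x ∈ P.chart i) (ho : x ∈ P.chart P.o),
  Path.Homotopic.Quotient.mk (P.path hi) = (P.loop (P.label i x)).trans (.mk (P.path ho))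

section Bundle

variable [DiscreteTopology G]

noncomputable def core : FiberBundleCore ι X G where
  baseSet := P.chart
  isOpen_baseSet := P.isOpen_chart
  indexAt x := (P.cover x).choose
  mem_baseSet_at x := (P.cover x).choose_spec
  coordChange i j x v := (P.label j x)⁻¹ * P.label i x * v
  coordChange_self i x _ v := by simp
  continuousOn_coordChange i j := by
    rcases eq_or_ne i j with rfl | h
    · simpa using continuous_snd.continuousOn
    · have h1 : ContinuousOn (P.label i) (P.chart i ∩ P.chart j) :=
        (P.continuousOn_label i).mono fun x hx => ⟨hx.1, P.inter_subset i j h hx⟩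
      have h2 : ContinuousOn (P.label j) (P.chart i ∩ P.chart j) :=
        (P.continuousOn_label j).mono fun x hx => ⟨hx.2, P.inter_subset i j h hx⟩
      have hf : Set.MapsTo (Prod.fst : X × G → X) ((P.chart i ∩ P.chart j) ×ˢ Set.univ)
        (P.chart i ∩ P.chart j) := fun z hz => hz.1
      exact ((h2.comp continuous_fst.continuousOn hf).inv.mul
        (h1.comp continuous_fst.continuousOn hf)).mul continuous_snd.continuousOn
  coordChange_comp i j k x _ v := by group

theorem isCoveringMap_proj : IsCoveringMap P.core.proj := FiberBundle.isCoveringMap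

/-- The coordinate of a point of the covering space in a chart. -/
noncomputable def coord (i : ι) (e : P.core.TotalSpace) : G :=
  P.core.coordChange (P.core.indexAt e.1) i e.1 e.2

noncomputable def sheet (i : ι) (v : G) (x : X) : P.core.TotalSpace :=
  ⟨x, P.core.coordChange i (P.core.indexAt x) x v⟩

theorem coord_sheet (i : ι) (v : G) (x : X) : P.coord i (P.sheet i v x) = v := by
  simp [coord, sheet, core, mul_assoc]

theorem sheet_coord (i : ι) (e : P.core.TotalSpace) : P.sheet i (P.coord i e) e.1 = e := by
  obtain ⟨x, v⟩ := e
  change G at v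
  exact congrArg (Bundle.TotalSpace.mk x) (by
    change (_ : G)⁻¹ * _ * ((_ : G)⁻¹ * _ * _) = (v : G)
    group)

theorem sheet_eq_sheet (i : ι) (v : G) (x : X) :
    P.sheet i v x = P.sheet P.o (P.label i x * v) x := by
  simp [sheet, core, P.label_o, mul_assoc]

theorem continuousOn_coord (i : ι) : ContinuousOn (P.coord i) (P.core.proj ⁻¹' P.chart i) :=
  continuous_snd.comp_continuousOn (P.core.localTriv i).continuousOn_toFun

theorem continuousOn_sheet (i : ι) (v : G) : ContinuousOn (P.sheet i v) (P.chart i) :=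
  (P.core.localTriv i).continuousOn_invFun.comp (f := fun x => (x, v)) (by fun_prop)
    fun x hx => ((P.core.localTriv i).mem_target).2 hx

theorem joined_sheet {i : ι} (v : G) {x y : X} (h : JoinedIn (P.chart i) x y) :
    Joined (P.sheet i v x) (P.sheet i v y) := by
  obtain ⟨γ, hγ⟩ := h
  exact ⟨⟨⟨fun t => P.sheet i v (γ t),
    (P.continuousOn_sheet i v).comp_continuous γ.continuous hγ⟩, by simp, by simp⟩⟩

/-- The homotopy class of paths to the base point under `e` which the covering assigns to `e`. -/
noncomputable def classAt (e : P.core.TotalSpace) : Path.Homotopic.Quotient x₀ e.1 :=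
  (P.loop e.2).trans (.mk (P.path (P.core.mem_baseSet_at e.1)))

variable {P}

theorem IsCompatible.classAt_eq (hP : P.IsCompatible) {i : ι} (e : P.core.TotalSpace)
    (hi : e.1 ∈ P.chart i) : P.classAt e = (P.loop (P.coord i e)).trans (.mk (P.path hi)) := by
  obtain ⟨x, v⟩ := e
  change G at v
  have hx : x ∈ P.chart (P.core.indexAt x) := P.core.mem_baseSet_at x
  rcases eq_or_ne (P.core.indexAt x) i with h | h
  · subst h
    rw [show P.coord (P.core.indexAt x) ⟨x, v⟩ = v from P.core.coordChange_self _ x hx v]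
    rfl
  · have ho := P.inter_subset _ _ h ⟨hx, hi⟩
    have hv : P.label i x * P.coord i ⟨x, v⟩ = P.label (P.core.indexAt x) x * v := by
      change P.label i x * ((P.label i x)⁻¹ * _ * v) = _
      group
    change (P.loop v).trans (.mk (P.path hx)) = _
    rw [hP _ _ hx ho, hP _ _ hi ho, ← Path.Homotopic.Quotient.trans_assoc,
      ← Path.Homotopic.Quotient.trans_assoc, ← P.loop_mul, ← P.loop_mul, hv]

theorem IsCompatible.classAt_trans (hP : P.IsCompatible) {e e' : P.core.TotalSpace}
    (Γ : Path e e') :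
    (P.classAt e).trans (.mk (Γ.map P.core.continuous_proj)) = P.classAt e' := by
  have key : ∀ t₀ : I, ∀ᶠ t in nhds t₀, (P.classAt (Γ t₀)).trans
      (.mk ((Γ.subpath t₀ t).map P.core.continuous_proj)) = P.classAt (Γ t) := by
    intro t₀
    obtain ⟨i, hi⟩ := P.cover (Γ t₀).1
    have ho : IsOpen (P.core.proj ⁻¹' P.chart i) :=
      (P.isOpen_chart i).preimage P.core.continuous_proj
    have hc : ∀ᶠ e in nhds (Γ t₀), e.1 ∈ P.chart i ∧ P.coord i e = P.coord i (Γ t₀) := by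
      refine Filter.Eventually.and (ho.mem_nhds hi) ?_
      exact ((P.continuousOn_coord i).continuousAt (ho.mem_nhds hi)).eventually_mem
        ((isOpen_discrete {P.coord i (Γ t₀)}).mem_nhds rfl)
    obtain ⟨a, b, ht, hab, hN⟩ := exists_Icc_mem_subset_of_mem_nhds
      (Γ.continuous.continuousAt.eventually hc)
    filter_upwards [hab] with t htab
    have hi' : (Γ t).1 ∈ P.chart i := (hN htab).1
    rw [hP.classAt_eq _ hi, hP.classAt_eq _ hi', (hN htab).2,
      Path.Homotopic.Quotient.trans_assoc, P.path_trans hi hi']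
    intro u
    have : (Γ.subpath t₀ t) u ∈ Set.image Γ (Set.uIcc t₀ t) := by
      rw [← Path.range_subpath]; exact ⟨u, rfl⟩
    obtain ⟨w, hw, hw'⟩ := this
    have := (hN (Set.uIcc_subset_Icc ht htab hw)).1
    rw [hw'] at this
    exact this
  let Q : I → Prop := fun t => (P.classAt (Γ 0)).trans
      (.mk ((Γ.subpath 0 t).map P.core.continuous_proj)) = P.classAt (Γ t)
  have hQ : IsLocallyConstant Q := by
    rw [IsLocallyConstant.iff_eventually_eq]
    intro t₀
    filter_upwards [key t₀] with t ht
    have h1 : (Path.Homotopic.Quotient.mk ((Γ.subpath 0 t).map P.core.continuous_proj)) =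
        (Path.Homotopic.Quotient.mk ((Γ.subpath 0 t₀).map P.core.continuous_proj)).trans
          (.mk ((Γ.subpath t₀ t).map P.core.continuous_proj)) := by
      rw [← Path.Homotopic.Quotient.mk_trans, ← Path.map_trans]
      exact Path.Homotopic.Quotient.eq.2
        (Path.Homotopic.map ⟨(Path.Homotopy.subpathTransSubpath Γ 0 t₀ t).symm⟩
          ⟨_, P.core.continuous_proj⟩)
    simp only [Q, eq_iff_iff]
    rw [h1, ← ht, ← Path.Homotopic.Quotient.trans_assoc]
    constructor
    · intro h
      simpa [Path.Homotopic.Quotient.trans_assoc] using congrArg (fun z => z.trans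
        (Path.Homotopic.Quotient.mk ((Γ.subpath t₀ t).map P.core.continuous_proj)).symm) h
    · intro h; rw [h]
  have h0 : Q 0 := by
    simp only [Q, Path.subpath_self]
    exact Path.Homotopic.Quotient.trans_refl _
  have h1 : Q 1 := by
    rw [hQ.apply_eq_of_preconnectedSpace 1 0]; exact h0
  have hcast : ∀ (a b : P.core.TotalSpace) (ha : a = e) (hb : b = e'), (P.classAt a).trans
      (.mk ((Γ.cast ha hb).map P.core.continuous_proj)) = P.classAt b →
      (P.classAt e).trans (.mk (Γ.map P.core.continuous_proj)) = P.classAt e' := by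
    rintro a b rfl rfl h
    exact h
  refine hcast _ _ Γ.source Γ.target ?_
  rw [← Path.subpath_zero_one]
  exact h1

theorem IsCompatible.loop_trans_path_trans (hP : P.IsCompatible) {i : ι} {v w : G} {x y : X}
    (hx : x ∈ P.chart i) (hy : y ∈ P.chart i) (Γ : Path (P.sheet i v x) (P.sheet i w y))
    (γ : Path x y) (hγ : ∀ t, (Γ t).1 = γ t) :
    ((P.loop v).trans (.mk (P.path hx))).trans (.mk γ) = (P.loop w).trans (.mk (P.path hy)) := by
  have hc := hP.classAt_trans Γ
  rw [hP.classAt_eq (P.sheet i v x) hx, hP.classAt_eq (P.sheet i w y) hy, P.coord_sheet,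
    P.coord_sheet] at hc
  obtain rfl : Γ.map P.core.continuous_proj = γ := Path.ext (funext hγ)
  exact hc

theorem IsCompatible.hom_bijective (hP : P.IsCompatible) (hx₀ : x₀ ∈ P.chart P.o)
    (hpc : IsPathConnected (P.chart P.o)) {A : Set G} (hA : Subgroup.closure A = ⊤)
    (hgen : ∀ a ∈ A, ∃ i, ∃ p ∈ P.chart P.o, ∃ q ∈ P.chart P.o, JoinedIn (P.chart i) p q ∧
      P.label i p = 1 ∧ P.label i q = a) : Function.Bijective P.hom := by
  constructor
  · rw [injective_iff_map_eq_one]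
    intro g hg
    have hstep : ∀ a ∈ A, ∀ h, Joined (P.sheet P.o h x₀) (P.sheet P.o (a * h) x₀) := by
      intro a ha h
      obtain ⟨i, p, hp, q, hq, hpq, hlp, hlq⟩ := hgen a ha
      have h1 := P.joined_sheet h (hpc.joinedIn _ hx₀ _ hp)
      have h2 := P.joined_sheet h hpq
      have h3 := P.joined_sheet (a * h) (hpc.joinedIn _ hq _ hx₀)
      rw [P.sheet_eq_sheet i h p, P.sheet_eq_sheet i h q, hlp, hlq, one_mul] at h2
      exact (h1.trans h2).trans h3
    have hall : ∀ g ∈ Subgroup.closure A, ∀ h,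
        Joined (P.sheet P.o h x₀) (P.sheet P.o (g * h) x₀) := by
      intro g hg
      induction hg using Subgroup.closure_induction with
      | mem a ha => exact hstep a ha
      | one => intro h; rw [one_mul]
      | mul a b _ _ iha ihb => intro h; rw [mul_assoc]; exact (ihb h).trans (iha _)
      | inv a _ ih => intro h; simpa using (ih (a⁻¹ * h)).symm
    obtain ⟨Γ⟩ := hall g (hA ▸ Subgroup.mem_top g) 1
    rw [mul_one] at Γ
    let γ : Path x₀ x₀ := Γ.map P.core.continuous_proj
    have hc := hP.loop_trans_path_trans hx₀ hx₀ Γ γ fun _ => rfl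
    rw [P.loop_one, show P.loop g = .refl x₀ from hg, Path.Homotopic.Quotient.refl_trans] at hc
    have hΓ : Path.Homotopic.Quotient.mk γ = .refl x₀ :=
      Path.Homotopic.Quotient.trans_left_cancel
        (hc.trans (Path.Homotopic.Quotient.trans_refl _).symm)
    have hm := P.isCoveringMap_proj.monodromy_map (.mk Γ)
    have hm' := congrArg Subtype.val hm
    rw [← Path.Homotopic.Quotient.mk_map] at hm'
    erw [show Path.Homotopic.Quotient.mk (Γ.map P.core.continuous_proj) = .refl x₀ from hΓ,
      IsCoveringMap.monodromy_refl] at hm'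
    have := congrArg (P.coord P.o) hm'
    simpa [P.coord_sheet] using this.symm
  · intro δ
    change Path.Homotopic.Quotient x₀ x₀ at δ
    obtain ⟨γ, hγ⟩ := Path.Homotopic.Quotient.mk_surjective
      (((Path.Homotopic.Quotient.mk (P.path hx₀)).symm.trans δ).trans (.mk (P.path hx₀)))
    obtain ⟨Γ, hΓ, hΓ0⟩ := P.isCoveringMap_proj.exists_path_lifts γ (P.sheet P.o 1 x₀) γ.source
    have hp1 : (Γ 1).1 = x₀ := (congrFun hΓ 1).trans γ.target
    obtain ⟨v, hv⟩ : ∃ v, Γ 1 = P.sheet P.o v x₀ := ⟨P.coord P.o (Γ 1),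
      (P.sheet_coord _ _).symm.trans (congrArg (P.sheet P.o (P.coord P.o (Γ 1))) hp1)⟩
    let Γ' : Path (P.sheet P.o 1 x₀) (P.sheet P.o v x₀) := ⟨Γ, hΓ0, hv⟩
    have hc' := hP.loop_trans_path_trans hx₀ hx₀ Γ' γ (congrFun hΓ)
    rw [P.loop_one, Path.Homotopic.Quotient.refl_trans] at hc'
    refine ⟨v, show P.loop v = δ from ?_⟩
    rw [hγ] at hc'
    refine Path.Homotopic.Quotient.trans_right_cancel (r := .mk (P.path hx₀)) ?_
    rw [← hc', Path.Homotopic.Quotient.trans_assoc, ← Path.Homotopic.Quotient.trans_assoc]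
    simp

end Bundle

end ChartPresentation

namespace UnitAddCircle

/-- The representative of a point of the circle in the interval `[a, a + 1)`. -/
noncomputable def rep (a : ℝ) (x : UnitAddCircle) : ℝ := AddCircle.equivIco 1 a x

theorem infinite : Infinite UnitAddCircle :=
  (AddCircle.equivIco (1 : ℝ) 0).infinite_iff.2 (Set.Ico_infinite (by norm_num)).to_subtype

theorem coe_rep (a : ℝ) (x : UnitAddCircle) : (rep a x : UnitAddCircle) = x :=
  (AddCircle.equivIco 1 a).symm_apply_apply x

theorem rep_coe {a u : ℝ} (hu : u ∈ Set.Ico a (a + 1)) : rep a (u : UnitAddCircle) = u :=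
  AddCircle.equivIco_coe_of_mem hu

theorem rep_mem_Ioo {a : ℝ} {x : UnitAddCircle} (hx : x ≠ (a : UnitAddCircle)) :
    rep a x ∈ Set.Ioo a (a + 1) := by
  have h : rep a x ∈ Set.Ico a (a + 1) := (AddCircle.equivIco 1 a x).2
  refine ⟨lt_of_le_of_ne h.1 fun h' => hx ?_, h.2⟩
  rw [h', coe_rep]

theorem coe_ne_of_mem_Ioo {a u : ℝ} (hu : u ∈ Set.Ioo a (a + 1)) :
    (u : UnitAddCircle) ≠ (a : UnitAddCircle) := fun h => by
  have h1 := rep_coe (Set.Ioo_subset_Ico_self hu)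
  rw [h, rep_coe ⟨le_rfl, by linarith⟩] at h1
  exact hu.1.ne h1

theorem continuousOn_rep (a : ℝ) : ContinuousOn (rep a) {(a : UnitAddCircle)}ᶜ :=
  (AddCircle.openPartialHomeomorphCoe 1 a).continuousOn_symm

theorem coe_sub_one (u : ℝ) : ((u - 1 : ℝ) : UnitAddCircle) = (u : UnitAddCircle) := by
  rw [AddCircle.coe_sub, AddCircle.coe_period, sub_zero]

theorem rep_half_of_lt {x : UnitAddCircle} (h0 : x ≠ 0) (h : rep 0 x < 1 / 2) :
    rep (-1 / 2) x = rep 0 x := by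
  have h1 := rep_mem_Ioo (a := 0) (x := x) (by simpa using h0)
  conv_lhs => rw [← coe_rep 0 x]
  exact rep_coe ⟨by linarith [h1.1], by linarith⟩

theorem rep_ne_half {x : UnitAddCircle} (h : x ≠ ((-1 / 2 : ℝ) : UnitAddCircle)) :
    rep 0 x ≠ 1 / 2 := fun h' => h <| by
  rw [← coe_rep 0 x, h', ← coe_sub_one]
  norm_num

/-- The segment from `1 / 4` to `x` in the circle cut at `a`. -/
noncomputable def slide (a t : ℝ) (x : UnitAddCircle) : UnitAddCircle :=
  ((1 / 4 + t * (rep a x - 1 / 4) : ℝ) : UnitAddCircle)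

theorem slide_zero (a : ℝ) (x : UnitAddCircle) : slide a 0 x = ((1 / 4 : ℝ) : UnitAddCircle) := by
  simp [slide]

theorem slide_one (a : ℝ) (x : UnitAddCircle) : slide a 1 x = x := by
  simp [slide, coe_rep]

theorem slide_mem_Ioo {a t r : ℝ} (ha : a < 1 / 4) (ha' : 1 / 4 < a + 1) (ht : 0 ≤ t)
    (ht' : t ≤ 1) (hr : r ∈ Set.Ioo a (a + 1)) :
    1 / 4 + t * (r - 1 / 4) ∈ Set.Ioo a (a + 1) := by
  have := (convex_Ioo a (a + 1)) ⟨ha, ha'⟩ hr (sub_nonneg.2 ht') ht (by ring)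
  simp only [smul_eq_mul] at this
  convert this using 1
  ring

theorem slide_ne {a t : ℝ} (ha : a < 1 / 4) (ha' : 1 / 4 < a + 1) (ht : 0 ≤ t) (ht' : t ≤ 1)
    {x : UnitAddCircle} (hx : x ≠ (a : UnitAddCircle)) : slide a t x ≠ (a : UnitAddCircle) :=
  coe_ne_of_mem_Ioo (slide_mem_Ioo ha ha' ht ht' (rep_mem_Ioo hx))

theorem continuous_slide {A : Type*} [TopologicalSpace A] {a : ℝ} {f : A → ℝ}
    {g : A → UnitAddCircle} (hf : Continuous f) (hg : Continuous g)
    (h : ∀ z, g z ≠ (a : UnitAddCircle)) : Continuous fun z => slide a (f z) (g z) := by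
  have := (continuousOn_rep a).comp_continuous hg h
  have hc : Continuous ((↑) : ℝ → UnitAddCircle) := AddCircle.continuous_mk' 1
  unfold slide
  exact hc.comp (by fun_prop)

end UnitAddCircle

theorem JoinedIn.subtype {X : Type*} [TopologicalSpace X] {K S : Set X} {x y : X}
    (h : JoinedIn K x y) (hK : K ⊆ S) :
    JoinedIn ((↑) ⁻¹' K : Set S) ⟨x, hK h.source_mem⟩ ⟨y, hK h.target_mem⟩ := by
  obtain ⟨γ, hγ⟩ := h
  exact ⟨⟨⟨fun t => ⟨γ t, hK (hγ t)⟩, by fun_prop⟩, by simp, by simp⟩, hγ⟩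

/-- The charts covering the torus minus finitely many points of a circle `{0} × S¹`. -/
inductive SlitChart
  | square
  | horizontal
  | vertical

namespace SlitChart

open UnitAddCircle

variable {Y : Set UnitAddCircle}

/-- The union of the squares cut out by the circle `{0} × S¹` and by another circle. -/
def baseSet (Y : Set UnitAddCircle) : SlitChart → Set (UnitAddCircle × UnitAddCircle)
  | square => {((0 : ℝ) : UnitAddCircle)}ᶜ ×ˢ {((0 : ℝ) : UnitAddCircle)}ᶜ
  | horizontal => {((-1 / 2 : ℝ) : UnitAddCircle)}ᶜ ×ˢ Yᶜ
  | vertical => {((0 : ℝ) : UnitAddCircle)}ᶜ ×ˢ {((-1 / 2 : ℝ) : UnitAddCircle)}ᶜ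

theorem isOpen_baseSet (hY : Y.Finite) (i : SlitChart) : IsOpen (baseSet Y i) := by
  cases i
  exacts [isOpen_compl_singleton.prod isOpen_compl_singleton,
    isOpen_compl_singleton.prod hY.isClosed.isOpen_compl,
    isOpen_compl_singleton.prod isOpen_compl_singleton]

noncomputable def slide (i : SlitChart) (t : ℝ) (z : UnitAddCircle × UnitAddCircle) :
    UnitAddCircle × UnitAddCircle :=
  match i with
  | square => (UnitAddCircle.slide 0 t z.1, UnitAddCircle.slide 0 t z.2)
  | horizontal => (UnitAddCircle.slide (-1 / 2) (max 0 (2 * t - 1)) z.1,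
      UnitAddCircle.slide 0 (min 1 (2 * t)) z.2)
  | vertical => (UnitAddCircle.slide 0 t z.1, UnitAddCircle.slide (-1 / 2) t z.2)

theorem ne_coe_zero (h0 : (0 : UnitAddCircle) ∈ Y) {y : UnitAddCircle} (hy : y ∈ Yᶜ) :
    y ≠ ((0 : ℝ) : UnitAddCircle) := by
  rintro rfl
  exact hy (by simpa using h0)

theorem continuous_slide (h0 : (0 : UnitAddCircle) ∈ Y) (i : SlitChart) {A : Type*}
    [TopologicalSpace A] {f : A → ℝ} {g : A → UnitAddCircle × UnitAddCircle} (hf : Continuous f)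
    (hg : Continuous g) (h : ∀ z, g z ∈ baseSet Y i) : Continuous fun z => slide i (f z) (g z) := by
  cases i
  · exact (UnitAddCircle.continuous_slide hf (by fun_prop) fun z => (h z).1).prodMk
      (UnitAddCircle.continuous_slide hf (by fun_prop) fun z => (h z).2)
  · exact (UnitAddCircle.continuous_slide (by fun_prop) (by fun_prop) fun z => (h z).1).prodMk
      (UnitAddCircle.continuous_slide (by fun_prop) (by fun_prop) fun z => ne_coe_zero h0 (h z).2)
  · exact (UnitAddCircle.continuous_slide hf (by fun_prop) fun z => (h z).1).prodMk
      (UnitAddCircle.continuous_slide hf (by fun_prop) fun z => (h z).2)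

theorem slide_mem (i : SlitChart) {t : ℝ} (ht : 0 ≤ t) (ht' : t ≤ 1)
    {z : UnitAddCircle × UnitAddCircle} (h : z ∈ baseSet Y i) :
    slide i t z ∈ (({0} : Set UnitAddCircle) ×ˢ Y)ᶜ := by
  rintro ⟨h1, h2⟩
  have key : ∀ x : UnitAddCircle, x ≠ ((0 : ℝ) : UnitAddCircle) → UnitAddCircle.slide 0 t x ≠ 0 :=
    fun x hx => by simpa using slide_ne (a := 0) (by norm_num) (by norm_num) ht ht' hx
  cases i
  · exact key _ h.1 h1
  · rcases le_total t (1 / 2) with h' | h'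
    · simp only [slide, max_eq_left (show 2 * t - 1 ≤ 0 by linarith), slide_zero] at h1
      exact coe_ne_of_mem_Ioo (a := 0) (u := 1 / 4) (by norm_num) (by simpa using h1)
    · simp only [slide, min_eq_left (show 1 ≤ 2 * t by linarith), slide_one] at h2
      exact h.2 h2
  · exact key _ h.1 h1

theorem slide_zero (i : SlitChart) (z : UnitAddCircle × UnitAddCircle) :
    slide i 0 z = (((1 / 4 : ℝ) : UnitAddCircle), ((1 / 4 : ℝ) : UnitAddCircle)) := by
  cases i <;> simp [slide, UnitAddCircle.slide_zero]

theorem slide_one (i : SlitChart) (z : UnitAddCircle × UnitAddCircle) : slide i 1 z = z := by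
  cases i <;> norm_num [slide, UnitAddCircle.slide_one]

open Classical in
/-- The generator attached to the component of a point in the complement of `Y`. -/
noncomputable def componentLabel (Y : Set UnitAddCircle) (y : UnitAddCircle) :
    FreeGroup (Option (ConnectedComponents ↥Yᶜ)) :=
  if h : y ∈ Yᶜ then .of (some (ConnectedComponents.mk ⟨y, h⟩)) else 1

open Classical in
/-- The generator crossed when leaving the square through a given side. -/
noncomputable def label (Y : Set UnitAddCircle) (i : SlitChart)
    (z : UnitAddCircle × UnitAddCircle) : FreeGroup (Option (ConnectedComponents ↥Yᶜ)) :=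
  match i with
  | square => 1
  | horizontal => if 1 / 2 < rep 0 z.1 then componentLabel Y z.2 else 1
  | vertical => if 1 / 2 < rep 0 z.2 then .of none else 1

theorem locallyPathConnectedSpace_compl (hY : Y.Finite) : LocallyPathConnectedSpace ↥Yᶜ := by
  have : LocallyPathConnectedSpace UnitAddCircle :=
    (QuotientAddGroup.isQuotientMap_mk (N := AddSubgroup.zmultiples (1 : ℝ))).locallyPathConnectedSpace
  exact hY.isClosed.isOpen_compl.locallyPathConnectedSpace

theorem discreteTopology_components (hY : Y.Finite) :
    DiscreteTopology (ConnectedComponents ↥Yᶜ) := by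
  have := locallyPathConnectedSpace_compl hY
  exact ConnectedComponents.discreteTopology_iff.2 fun x => isOpen_connectedComponent

open Classical in
theorem _root_.ContinuousOn.ite_lt {A B : Type*} [TopologicalSpace A] [TopologicalSpace B]
    {s : Set A} {u : A → ℝ} {c : ℝ} {f g : A → B} (hu : ContinuousOn u s) (hc : ∀ a ∈ s, u a ≠ c)
    (hf : ContinuousOn f s) (hg : ContinuousOn g s) :
    ContinuousOn (fun a => if c < u a then f a else g a) s := by
  intro a ha
  rcases lt_or_gt_of_ne (hc a ha) with h | h
  · refine (hg a ha).congr_of_eventuallyEq ?_ (if_neg h.not_gt)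
    filter_upwards [(hu a ha).eventually_lt_const h] with b hb using if_neg hb.not_gt
  · refine (hf a ha).congr_of_eventuallyEq ?_ (if_pos h)
    filter_upwards [(hu a ha).eventually_const_lt h] with b hb using if_pos hb

theorem inter_subset (h0 : (0 : UnitAddCircle) ∈ Y) {i j : SlitChart} (h : i ≠ j) :
    baseSet Y i ∩ baseSet Y j ⊆ baseSet Y square := by
  rintro z ⟨h1, h2⟩
  cases i <;> cases j
  all_goals first
    | exact absurd rfl h
    | exact h1
    | exact h2
    | exact ⟨h1.1, ne_coe_zero h0 h2.2⟩
    | exact ⟨h2.1, ne_coe_zero h0 h1.2⟩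

theorem exists_mem_baseSet {z : UnitAddCircle × UnitAddCircle}
    (hz : z ∈ (({0} : Set UnitAddCircle) ×ˢ Y)ᶜ) : ∃ i, z ∈ baseSet Y i := by
  have h0 : (0 : UnitAddCircle) ≠ ((-1 / 2 : ℝ) : UnitAddCircle) := by
    have := coe_ne_of_mem_Ioo (a := -1 / 2) (u := 0) (by norm_num)
    simpa using this
  obtain ⟨x, y⟩ := z
  by_cases hx : x = 0
  · subst hx
    exact ⟨horizontal, h0, fun hy => hz ⟨rfl, hy⟩⟩
  by_cases hy : y = 0
  · subst hy
    exact ⟨vertical, by simpa using hx, h0⟩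
  · exact ⟨square, by simpa using hx, by simpa using hy⟩

/-- The base point of the slit torus. -/
noncomputable def base (Y : Set UnitAddCircle) : ↥(({0} : Set UnitAddCircle) ×ˢ Y)ᶜ :=
  ⟨(((1 / 4 : ℝ) : UnitAddCircle), ((1 / 4 : ℝ) : UnitAddCircle)), fun h => by
    have := coe_ne_of_mem_Ioo (a := 0) (u := 1 / 4) (by norm_num)
    exact this (by simpa using h.1)⟩

section Label

variable [TopologicalSpace (FreeGroup (Option (ConnectedComponents ↥Yᶜ)))]

theorem continuousOn_componentLabel (hY : Y.Finite) : ContinuousOn (componentLabel Y) Yᶜ := by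
  have := discreteTopology_components hY
  rw [continuousOn_iff_continuous_domRestrict]
  have h : Yᶜ.domRestrict (componentLabel Y) =
      fun y => (fun c => FreeGroup.of (some c)) (ConnectedComponents.mk y) := by
    ext1 y
    exact dif_pos y.2
  rw [h]
  have hc : Continuous fun c : ConnectedComponents ↥Yᶜ => FreeGroup.of (some c) :=
    continuous_of_discreteTopology
  exact hc.comp ConnectedComponents.continuous_coe

theorem continuousOn_label (hY : Y.Finite) (i : SlitChart) :
    ContinuousOn (label Y i) (baseSet Y i ∩ baseSet Y square) := by
  cases i
  · exact continuousOn_const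
  · exact ContinuousOn.ite_lt
      ((continuousOn_rep 0).comp continuous_fst.continuousOn fun z hz => hz.2.1)
      (fun z hz => rep_ne_half hz.1.1)
      ((continuousOn_componentLabel hY).comp continuous_snd.continuousOn fun z hz => hz.1.2)
      continuousOn_const
  · exact ContinuousOn.ite_lt
      ((continuousOn_rep 0).comp continuous_snd.continuousOn fun z hz => hz.2.2)
      (fun z hz => rep_ne_half hz.1.2) continuousOn_const continuousOn_const

noncomputable def chartSystem (hY : Y.Finite) (h0 : (0 : UnitAddCircle) ∈ Y) :
    ChartSystem ↥(({0} : Set UnitAddCircle) ×ˢ Y)ᶜ (base Y) SlitChart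
      (FreeGroup (Option (ConnectedComponents ↥Yᶜ))) where
  chart i := Subtype.val ⁻¹' baseSet Y i
  isOpen_chart i := (isOpen_baseSet hY i).preimage continuous_subtype_val
  cover z := exists_mem_baseSet z.2
  o := square
  inter_subset i j h z hz := inter_subset h0 h hz
  label i z := label Y i z
  label_o z := rfl
  continuousOn_label i := (continuousOn_label hY i).comp continuous_subtype_val.continuousOn
    fun z hz => hz
  contr i := ⟨fun z => ⟨slide i z.1 z.2, slide_mem i z.1.2.1 z.1.2.2 z.2.2⟩,
    (continuous_slide h0 i (f := fun z : I × _ => (z.1 : ℝ)) (by fun_prop) (by fun_prop)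
      fun z => z.2.2).subtype_mk _⟩
  contr_zero i z := Subtype.ext (slide_zero i z)
  contr_one i z := Subtype.ext (slide_one i z)

end Label

end SlitChart

namespace SlitChart

open UnitAddCircle

variable {Y : Set UnitAddCircle}

theorem mem_baseSet_square {u v : ℝ} (hu : u ∈ Set.Ioo (0 : ℝ) 1) (hv : v ∈ Set.Ioo (0 : ℝ) 1) :
    ((u : UnitAddCircle), (v : UnitAddCircle)) ∈ baseSet Y square :=
  ⟨coe_ne_of_mem_Ioo (by simpa using hu), coe_ne_of_mem_Ioo (by simpa using hv)⟩

theorem mem_baseSet_vertical {u v : ℝ} (hu : u ∈ Set.Ioo (0 : ℝ) 1)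
    (hv : v ∈ Set.Ioo (-1 / 2 : ℝ) (1 / 2)) :
    ((u : UnitAddCircle), (v : UnitAddCircle)) ∈ baseSet Y vertical :=
  ⟨coe_ne_of_mem_Ioo (by simpa using hu), coe_ne_of_mem_Ioo (by norm_num at hv ⊢; exact hv)⟩

theorem mem_baseSet_horizontal {u : ℝ} {y : UnitAddCircle} (hu : u ∈ Set.Ioo (-1 / 2 : ℝ) (1 / 2))
    (hy : y ∈ Yᶜ) : ((u : UnitAddCircle), y) ∈ baseSet Y horizontal :=
  ⟨coe_ne_of_mem_Ioo (by norm_num at hu ⊢; exact hu), hy⟩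

theorem _root_.UnitAddCircle.joinedIn_coe {a b u v : ℝ} {K : Set UnitAddCircle}
    (hK : ∀ w ∈ Set.Ioo a b, (w : UnitAddCircle) ∈ K)
    (hu : u ∈ Set.Ioo a b) (hv : v ∈ Set.Ioo a b) :
    JoinedIn K (u : UnitAddCircle) (v : UnitAddCircle) := by
  have h := ((convex_Ioo a b).isPathConnected ⟨u, hu⟩).joinedIn u hu v hv
  obtain ⟨γ, hγ⟩ := h
  exact ⟨γ.map (AddCircle.continuous_mk' 1), fun t => hK _ (hγ t)⟩

theorem _root_.JoinedIn.prodMk {A B : Type*} [TopologicalSpace A] [TopologicalSpace B]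
    {s : Set A} {t : Set B} {a a' : A} {b b' : B} (h : JoinedIn s a a') (h' : JoinedIn t b b') :
    JoinedIn (s ×ˢ t) (a, b) (a', b') := by
  obtain ⟨γ, hγ⟩ := h
  obtain ⟨δ, hδ⟩ := h'
  exact ⟨γ.prod δ, fun r => ⟨hγ r, hδ r⟩⟩

theorem _root_.UnitAddCircle.joinedIn_of_rep_gt {x y : UnitAddCircle}
    (hx : x ≠ ((0 : ℝ) : UnitAddCircle)) (hy : y ≠ ((0 : ℝ) : UnitAddCircle))
    (hx' : 1 / 2 < rep 0 x) (hy' : 1 / 2 < rep 0 y) :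
    JoinedIn ({((-1 / 2 : ℝ) : UnitAddCircle)}ᶜ ∩ {((0 : ℝ) : UnitAddCircle)}ᶜ) x y := by
  rw [← coe_rep 0 x, ← coe_rep 0 y]
  refine joinedIn_coe (a := 1 / 2) (b := 1) (fun u hu => ⟨?_, ?_⟩)
    ⟨hx', by linarith [(rep_mem_Ioo hx).2]⟩ ⟨hy', by linarith [(rep_mem_Ioo hy).2]⟩
  · rw [Set.mem_compl_singleton_iff, ← coe_sub_one]
    exact coe_ne_of_mem_Ioo ⟨by linarith [hu.1], by linarith [hu.2]⟩
  · exact coe_ne_of_mem_Ioo ⟨by linarith [hu.1], by linarith [hu.2]⟩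

theorem three_quarters_mem : (3 / 4 : ℝ) ∈ Set.Ioo (0 : ℝ) 1 := by norm_num

theorem quarter_mem : (1 / 4 : ℝ) ∈ Set.Ioo (0 : ℝ) 1 := by norm_num

theorem coe_mem_baseSet_square (h0 : (0 : UnitAddCircle) ∈ Y) {u : ℝ} {y : UnitAddCircle}
    (hu : u ∈ Set.Ioo (0 : ℝ) 1) (hy : y ∈ Yᶜ) : ((u : UnitAddCircle), y) ∈ baseSet Y square :=
  ⟨coe_ne_of_mem_Ioo (by simpa using hu), ne_coe_zero h0 hy⟩

theorem mem_of_baseSet_square {z : UnitAddCircle × UnitAddCircle} (h : z ∈ baseSet Y square) :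
    z ∈ (({0} : Set UnitAddCircle) ×ˢ Y)ᶜ := fun h' => h.1 (by simpa using h'.1)

/-- A point on the far side of the vertical chart. -/
noncomputable def verticalPoint (Y : Set UnitAddCircle) : ↥(({0} : Set UnitAddCircle) ×ˢ Y)ᶜ :=
  ⟨(((1 / 4 : ℝ) : UnitAddCircle), ((3 / 4 : ℝ) : UnitAddCircle)),
    mem_of_baseSet_square (mem_baseSet_square quarter_mem three_quarters_mem)⟩

theorem coe_three_quarters : ((3 / 4 : ℝ) : UnitAddCircle) = ((-1 / 4 : ℝ) : UnitAddCircle) := by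
  rw [← coe_sub_one]
  norm_num

theorem rep_three_quarters : rep 0 ((3 / 4 : ℝ) : UnitAddCircle) = 3 / 4 := rep_coe (by norm_num)

theorem verticalPoint_mem : (verticalPoint Y).1 ∈ baseSet Y vertical := by
  have h := mem_baseSet_vertical (Y := Y) quarter_mem (v := -1 / 4) (by norm_num)
  rwa [← coe_three_quarters] at h

theorem verticalPoint_mem_square : (verticalPoint Y).1 ∈ baseSet Y square :=
  mem_baseSet_square quarter_mem three_quarters_mem

/-- A point of a connected component of the complement of `Y`. -/
noncomputable def componentPoint (c : ConnectedComponents ↥Yᶜ) : ↥Yᶜ :=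
  Function.surjInv ConnectedComponents.surjective_coe c

theorem mk_componentPoint (c : ConnectedComponents ↥Yᶜ) :
    ConnectedComponents.mk (componentPoint c) = c := Function.surjInv_eq _ c

theorem componentLabel_componentPoint (c : ConnectedComponents ↥Yᶜ) :
    componentLabel Y (componentPoint c) = .of (some c) := by
  rw [componentLabel, dif_pos (componentPoint c).2]
  exact congrArg (fun c => FreeGroup.of (some c)) (mk_componentPoint c)

/-- A point on the far side of the horizontal chart, at the height of a given component. -/
noncomputable def horizontalPoint (h0 : (0 : UnitAddCircle) ∈ Y) (c : ConnectedComponents ↥Yᶜ) :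
    ↥(({0} : Set UnitAddCircle) ×ˢ Y)ᶜ :=
  ⟨(((3 / 4 : ℝ) : UnitAddCircle), componentPoint c),
    mem_of_baseSet_square (coe_mem_baseSet_square h0 three_quarters_mem (componentPoint c).2)⟩

theorem horizontalPoint_mem (h0 : (0 : UnitAddCircle) ∈ Y) (c : ConnectedComponents ↥Yᶜ) :
    (horizontalPoint h0 c).1 ∈ baseSet Y horizontal := by
  have h := mem_baseSet_horizontal (u := -1 / 4) (by norm_num) (componentPoint c).2
  rwa [← coe_three_quarters] at h

theorem horizontalPoint_mem_square (h0 : (0 : UnitAddCircle) ∈ Y) (c : ConnectedComponents ↥Yᶜ) :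
    (horizontalPoint h0 c).1 ∈ baseSet Y square :=
  coe_mem_baseSet_square h0 three_quarters_mem (componentPoint c).2

theorem base_mem_square : (base Y).1 ∈ baseSet Y square :=
  mem_baseSet_square quarter_mem quarter_mem

section Presentation

variable [TopologicalSpace (FreeGroup (Option (ConnectedComponents ↥Yᶜ)))]

theorem path_apply (hY : Y.Finite) (h0 : (0 : UnitAddCircle) ∈ Y) {i : SlitChart}
    {z : ↥(({0} : Set UnitAddCircle) ×ˢ Y)ᶜ} (hz : z ∈ (chartSystem hY h0).chart i) (t : I) :
    ((chartSystem hY h0).path hz t).1 = slide i t z.1 := rfl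

theorem transition_vertical (hY : Y.Finite) (h0 : (0 : UnitAddCircle) ∈ Y)
    {z w : ↥(({0} : Set UnitAddCircle) ×ˢ Y)ᶜ}
    (hz : z ∈ (chartSystem hY h0).chart vertical) (hz' : z ∈ (chartSystem hY h0).chart square)
    (hw : w ∈ (chartSystem hY h0).chart vertical) (hw' : w ∈ (chartSystem hY h0).chart square)
    (h1 : 1 / 2 < rep 0 z.1.2) (h2 : 1 / 2 < rep 0 w.1.2) :
    (chartSystem hY h0).transition hz hz' = (chartSystem hY h0).transition hw hw' := by
  apply ChartSystem.transition_eq_of_joinedIn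
  have hx : JoinedIn {((0 : ℝ) : UnitAddCircle)}ᶜ z.1.1 w.1.1 := by
    rw [← coe_rep 0 z.1.1, ← coe_rep 0 w.1.1]
    exact joinedIn_coe (fun u hu => coe_ne_of_mem_Ioo hu) (rep_mem_Ioo hz'.1) (rep_mem_Ioo hw'.1)
  have hy := joinedIn_of_rep_gt hz'.2 hw'.2 h1 h2
  have := (hx.prodMk hy).subtype (S := (({0} : Set UnitAddCircle) ×ˢ Y)ᶜ)
    fun p hp h => hp.1 (by simpa using h.1)
  exact this.mono fun p hp => ⟨⟨hp.1, hp.2.1⟩, hp.1, hp.2.2⟩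

theorem transition_horizontal (hY : Y.Finite) (h0 : (0 : UnitAddCircle) ∈ Y)
    {z w : ↥(({0} : Set UnitAddCircle) ×ˢ Y)ᶜ}
    (hz : z ∈ (chartSystem hY h0).chart horizontal) (hz' : z ∈ (chartSystem hY h0).chart square)
    (hw : w ∈ (chartSystem hY h0).chart horizontal) (hw' : w ∈ (chartSystem hY h0).chart square)
    (h1 : 1 / 2 < rep 0 z.1.1) (h2 : 1 / 2 < rep 0 w.1.1)
    (hc : componentLabel Y z.1.2 = componentLabel Y w.1.2) :
    (chartSystem hY h0).transition hz hz' = (chartSystem hY h0).transition hw hw' := by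
  apply ChartSystem.transition_eq_of_joinedIn
  have hx := joinedIn_of_rep_gt hz'.1 hw'.1 h1 h2
  have hy : JoinedIn Yᶜ z.1.2 w.1.2 := by
    have := locallyPathConnectedSpace_compl hY
    have hz2 : z.1.2 ∈ Yᶜ := hz.2
    have hw2 : w.1.2 ∈ Yᶜ := hw.2
    rw [componentLabel, componentLabel, dif_pos hz2, dif_pos hw2] at hc
    have h := ConnectedComponents.coe_eq_coe.1 (Option.some_injective _ (FreeGroup.of_injective hc))
    rw [connectedComponent_eq_iff_joined] at h
    exact joinedIn_iff_joined hz2 hw2 |>.2 h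
  have := (hx.prodMk hy).subtype (S := (({0} : Set UnitAddCircle) ×ˢ Y)ᶜ)
    fun p hp h => hp.1.2 (by simpa using h.1)
  exact this.mono fun p hp => ⟨⟨hp.1.1, hp.2⟩, hp.1.2, ne_coe_zero h0 hp.2⟩

noncomputable def presentation (hY : Y.Finite) (h0 : (0 : UnitAddCircle) ∈ Y) :
    ChartPresentation ↥(({0} : Set UnitAddCircle) ×ˢ Y)ᶜ (base Y) SlitChart
      (FreeGroup (Option (ConnectedComponents ↥Yᶜ))) where
  toChartSystem := chartSystem hY h0
  hom := FreeGroup.lift (β := FundamentalGroup _ (base Y)) fun c => c.elim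
    ((chartSystem hY h0).transition (i := vertical) (x := verticalPoint Y) verticalPoint_mem
      verticalPoint_mem_square)
    fun c => (chartSystem hY h0).transition (i := horizontal) (x := horizontalPoint h0 c)
      (horizontalPoint_mem h0 c) (horizontalPoint_mem_square h0 c)

theorem presentation_loop_none (hY : Y.Finite) (h0 : (0 : UnitAddCircle) ∈ Y) :
    (presentation hY h0).loop (.of none) =
      (chartSystem hY h0).transition (i := vertical) (x := verticalPoint Y) verticalPoint_mem
        verticalPoint_mem_square :=
  FreeGroup.lift_apply_of (β := FundamentalGroup _ (base Y))

theorem presentation_loop_some (hY : Y.Finite) (h0 : (0 : UnitAddCircle) ∈ Y)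
    (c : ConnectedComponents ↥Yᶜ) :
    (presentation hY h0).loop (.of (some c)) =
      (chartSystem hY h0).transition (i := horizontal) (x := horizontalPoint h0 c)
        (horizontalPoint_mem h0 c) (horizontalPoint_mem_square h0 c) :=
  FreeGroup.lift_apply_of (β := FundamentalGroup _ (base Y))

theorem path_horizontal (hY : Y.Finite) (h0 : (0 : UnitAddCircle) ∈ Y)
    {z : ↥(({0} : Set UnitAddCircle) ×ˢ Y)ᶜ} (hz : z ∈ (chartSystem hY h0).chart horizontal)
    (hz' : z ∈ (chartSystem hY h0).chart square) (h : rep 0 z.1.1 < 1 / 2) :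
    Path.Homotopic.Quotient.mk ((chartSystem hY h0).path hz) =
      .mk ((chartSystem hY h0).path hz') := by
  have hu := rep_mem_Ioo hz'.1
  have hv := rep_mem_Ioo hz'.2
  have hr := rep_half_of_lt (by simpa using hz'.1) h
  have key : ∀ r ∈ Set.Ioo (0 : ℝ) (0 + 1), ∀ t ∈ I, 1 / 4 + t * (r - 1 / 4) ∈
      Set.Ioo (0 : ℝ) (0 + 1) := fun r hr t ht =>
    slide_mem_Ioo (by norm_num) (by norm_num) ht.1 ht.2 hr
  have hmax : ∀ t ∈ I, max 0 (2 * t - 1) ∈ I := fun t ht =>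
    ⟨le_max_left _ _, max_le zero_le_one (by linarith [ht.2])⟩
  let a : I × I → ℝ := fun m =>
    (1 - m.2) * (1 / 4 + (max 0 (2 * m.1 - 1) : ℝ) * (rep 0 z.1.1 - 1 / 4)) +
      m.2 * (1 / 4 + m.1 * (rep 0 z.1.1 - 1 / 4))
  let b : I × I → ℝ := fun m =>
    (1 - m.2) * (1 / 4 + (min 1 (2 * m.1) : ℝ) * (rep 0 z.1.2 - 1 / 4)) +
      m.2 * (1 / 4 + m.1 * (rep 0 z.1.2 - 1 / 4))
  have ha : ∀ m, a m ∈ Set.Ioo (0 : ℝ) (0 + 1) := fun m =>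
    convex_Ioo _ _ (key _ hu _ (hmax _ m.1.2)) (key _ hu _ m.1.2)
      (sub_nonneg.2 m.2.2.2) m.2.2.1 (by ring)
  have hc : Continuous ((↑) : ℝ → UnitAddCircle) := AddCircle.continuous_mk' 1
  have hM := Path.square_homotopic
    (fun m : I × I => (⟨((a m : UnitAddCircle), (b m : UnitAddCircle)), fun h =>
      coe_ne_of_mem_Ioo (ha m) (by simpa using h.1)⟩ : ↥(({0} : Set UnitAddCircle) ×ˢ Y)ᶜ))
    (by fun_prop)
    ((chartSystem hY h0).path hz) (Path.refl _) (Path.refl _) ((chartSystem hY h0).path hz')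
    (fun t => Subtype.ext ?_) (fun t => Subtype.ext ?_) (fun t => Subtype.ext ?_)
    (fun t => Subtype.ext ?_)
  · simpa [Path.Homotopic.Quotient.mk_trans] using Path.Homotopic.Quotient.eq.2 hM
  · rw [path_apply]
    simp only [slide, UnitAddCircle.slide, a, b, hr]
    norm_num
  · refine Prod.ext ?_ ?_
    · change z.1.1 = ((a (1, t) : ℝ) : UnitAddCircle)
      have : a (1, t) = rep 0 z.1.1 := by
        simp only [a, Set.Icc.coe_one]
        norm_num
        ring
      rw [this, coe_rep]
    · change z.1.2 = ((b (1, t) : ℝ) : UnitAddCircle)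
      have : b (1, t) = rep 0 z.1.2 := by
        simp only [b, Set.Icc.coe_one]
        norm_num
        ring
      rw [this, coe_rep]
  · have h1 : a (0, t) = 1 / 4 := by
      simp only [a, Set.Icc.coe_zero]
      norm_num
      ring
    have h2 : b (0, t) = 1 / 4 := by
      simp only [b, Set.Icc.coe_zero]
      norm_num
      ring
    simp only [h1, h2]
    rfl
  · rw [path_apply]
    simp only [slide, UnitAddCircle.slide, a, b]
    norm_num

theorem path_vertical (hY : Y.Finite) (h0 : (0 : UnitAddCircle) ∈ Y)
    {z : ↥(({0} : Set UnitAddCircle) ×ˢ Y)ᶜ} (hz : z ∈ (chartSystem hY h0).chart vertical)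
    (hz' : z ∈ (chartSystem hY h0).chart square) (h : rep 0 z.1.2 < 1 / 2) :
    (chartSystem hY h0).path hz = (chartSystem hY h0).path hz' := by
  have hr := rep_half_of_lt (by simpa using hz'.2) h
  refine Path.ext (funext fun t => Subtype.ext ?_)
  rw [path_apply, path_apply]
  simp only [slide, UnitAddCircle.slide, hr]

theorem isCompatible_presentation (hY : Y.Finite) (h0 : (0 : UnitAddCircle) ∈ Y) :
    (presentation hY h0).IsCompatible := by
  intro i z hi ho
  have hmk : ∀ {g}, (presentation hY h0).label i z = g →
      (presentation hY h0).loop g = (chartSystem hY h0).transition hi ho →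
      Path.Homotopic.Quotient.mk ((presentation hY h0).path hi) =
        ((presentation hY h0).loop ((presentation hY h0).label i z)).trans
          (.mk ((presentation hY h0).path ho)) := by
    rintro g rfl h
    rw [h]
    exact ((chartSystem hY h0).transition_trans hi ho).symm
  cases i
  · refine hmk (g := 1) rfl ?_
    rw [ChartPresentation.loop_one]
    exact ((chartSystem hY h0).transition_eq_refl rfl).symm
  · rcases lt_or_gt_of_ne (rep_ne_half hi.1) with h | h
    · refine hmk (g := 1) (if_neg h.not_gt) ?_
      rw [ChartPresentation.loop_one]
      exact ((chartSystem hY h0).transition_eq_refl (path_horizontal hY h0 hi ho h)).symm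
    · refine hmk (g := .of (some (.mk ⟨z.1.2, hi.2⟩))) ((if_pos h).trans (dif_pos hi.2)) ?_
      rw [presentation_loop_some]
      refine transition_horizontal hY h0 _ _ _ _ ?_ h ?_
      · rw [horizontalPoint, rep_three_quarters]
        norm_num
      · rw [horizontalPoint, componentLabel_componentPoint]
        rw [componentLabel, dif_pos (show z.1.2 ∈ Yᶜ from hi.2)]
  · rcases lt_or_gt_of_ne (rep_ne_half hi.2) with h | h
    · refine hmk (g := 1) (if_neg h.not_gt) ?_
      rw [ChartPresentation.loop_one]
      exact ((chartSystem hY h0).transition_eq_refl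
        (congrArg Path.Homotopic.Quotient.mk (path_vertical hY h0 hi ho h))).symm
    · refine hmk (g := .of none) (if_pos h) ?_
      rw [presentation_loop_none]
      refine transition_vertical hY h0 _ _ _ _ ?_ h
      rw [verticalPoint, rep_three_quarters]
      norm_num

theorem isPathConnected_chart_square (hY : Y.Finite) (h0 : (0 : UnitAddCircle) ∈ Y) :
    IsPathConnected ((chartSystem hY h0).chart square) :=
  ⟨base Y, base_mem_square, fun {_} hz => ⟨(chartSystem hY h0).path hz, fun t =>
    ⟨slide_ne (by norm_num) (by norm_num) t.2.1 t.2.2 hz.1,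
      slide_ne (by norm_num) (by norm_num) t.2.1 t.2.2 hz.2⟩⟩⟩

theorem joinedIn_vertical (hY : Y.Finite) (h0 : (0 : UnitAddCircle) ∈ Y) :
    JoinedIn ((chartSystem hY h0).chart vertical) (base Y) (verticalPoint Y) := by
  have hx : JoinedIn {((0 : ℝ) : UnitAddCircle)}ᶜ ((1 / 4 : ℝ) : UnitAddCircle)
      ((1 / 4 : ℝ) : UnitAddCircle) := JoinedIn.refl (base_mem_square (Y := Y)).1
  have hy : JoinedIn {((-1 / 2 : ℝ) : UnitAddCircle)}ᶜ ((1 / 4 : ℝ) : UnitAddCircle)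
      ((3 / 4 : ℝ) : UnitAddCircle) := by
    rw [coe_three_quarters]
    exact joinedIn_coe (a := -1 / 2) (b := -1 / 2 + 1) (fun u hu => coe_ne_of_mem_Ioo hu)
      (by norm_num) (by norm_num)
  exact (hx.prodMk hy).subtype (S := (({0} : Set UnitAddCircle) ×ˢ Y)ᶜ)
    fun p hp h => hp.1 (by simpa using h.1)

theorem joinedIn_horizontal (hY : Y.Finite) (h0 : (0 : UnitAddCircle) ∈ Y)
    (c : ConnectedComponents ↥Yᶜ) :
    ∃ z, z.1.1 = ((1 / 4 : ℝ) : UnitAddCircle) ∧ z ∈ (chartSystem hY h0).chart square ∧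
      JoinedIn ((chartSystem hY h0).chart horizontal) z (horizontalPoint h0 c) := by
  have hx : JoinedIn {((-1 / 2 : ℝ) : UnitAddCircle)}ᶜ ((1 / 4 : ℝ) : UnitAddCircle)
      ((3 / 4 : ℝ) : UnitAddCircle) := by
    rw [coe_three_quarters]
    exact joinedIn_coe (a := -1 / 2) (b := -1 / 2 + 1) (fun u hu => coe_ne_of_mem_Ioo hu)
      (by norm_num) (by norm_num)
  have hy : JoinedIn Yᶜ (componentPoint c).1 (componentPoint c).1 :=
    JoinedIn.refl (componentPoint c).2
  exact ⟨_, rfl, coe_mem_baseSet_square h0 quarter_mem (componentPoint c).2,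
    (hx.prodMk hy).subtype (S := (({0} : Set UnitAddCircle) ×ˢ Y)ᶜ)
      fun p hp h => hp.2 h.2⟩

theorem rep_quarter : rep 0 ((1 / 4 : ℝ) : UnitAddCircle) = 1 / 4 := rep_coe (by norm_num)

theorem exists_label_eq_of (hY : Y.Finite) (h0 : (0 : UnitAddCircle) ∈ Y)
    (c : Option (ConnectedComponents ↥Yᶜ)) :
    ∃ i, ∃ p ∈ (chartSystem hY h0).chart square, ∃ q ∈ (chartSystem hY h0).chart square,
      JoinedIn ((chartSystem hY h0).chart i) p q ∧
        label Y i p.1 = 1 ∧ label Y i q.1 = FreeGroup.of c := by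
  rcases c with _ | c
  · refine ⟨vertical, base Y, base_mem_square, verticalPoint Y, verticalPoint_mem_square,
      joinedIn_vertical hY h0, if_neg ?_, if_pos ?_⟩
    · rw [base, rep_quarter]
      norm_num
    · rw [verticalPoint, rep_three_quarters]
      norm_num
  · obtain ⟨z, hz, hz', h⟩ := joinedIn_horizontal hY h0 c
    refine ⟨horizontal, z, hz', horizontalPoint h0 c, horizontalPoint_mem_square h0 c,
      h, if_neg ?_, (if_pos ?_).trans (componentLabel_componentPoint c)⟩
    · rw [hz, rep_quarter]
      norm_num
    · rw [horizontalPoint, rep_three_quarters]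
      norm_num

end Presentation

theorem hasTrivialCenterAt_base (hY : Y.Finite) (h0 : (0 : UnitAddCircle) ∈ Y) :
    HasTrivialCenterAt (base Y) := by
  let _ : TopologicalSpace (FreeGroup (Option (ConnectedComponents ↥Yᶜ))) := ⊥
  have : DiscreteTopology (FreeGroup (Option (ConnectedComponents ↥Yᶜ))) := ⟨rfl⟩
  have hb := (isCompatible_presentation hY h0).hom_bijective base_mem_square
    (isPathConnected_chart_square hY h0) (FreeGroup.closure_range_of _)
    (by rintro _ ⟨c, rfl⟩; exact exists_label_eq_of hY h0 c)
  have := UnitAddCircle.infinite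
  obtain ⟨y, hy⟩ := hY.infinite_compl.nonempty
  have : Nonempty (ConnectedComponents ↥Yᶜ) := ⟨.mk ⟨y, hy⟩⟩
  rw [← center_fundamentalGroup_eq_bot_iff]
  exact (MulEquiv.ofBijective _ hb).center_eq_bot (FreeGroup.center_eq_bot _)

end SlitChart

theorem HasTrivialCenterAt.of_homeomorph {X Y : Type*} [TopologicalSpace X] [TopologicalSpace Y]
    (e : X ≃ₜ Y) {y : Y} (h : HasTrivialCenterAt (e.symm y)) : HasTrivialCenterAt y := by
  have key : ∀ (f : Y → Y) (hf : Continuous f), f = id → ∀ p : Path y y,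
      Path.Homotopic.Quotient.mk (p.map hf) = .refl (f y) →
      Path.Homotopic.Quotient.mk p = .refl y := by
    rintro _ _ rfl p hp
    exact hp
  intro γ hγ
  induction γ using Path.Homotopic.Quotient.ind with | mk p
  have hp := h (.mk (p.map e.symm.continuous)) fun δ => by
    induction δ using Path.Homotopic.Quotient.ind with | mk q
    let q' : Path y y := (q.map e.continuous).cast (by simp) (by simp)
    have hq : q'.map e.symm.continuous = q := by
      ext t
      simp [q']
    have h1 : (p.trans q').Homotopic (q'.trans p) := Path.Homotopic.Quotient.exact (hγ (.mk q'))
    have h2 := Path.Homotopic.Quotient.eq.2 (h1.map ⟨e.symm, e.symm.continuous⟩)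
    simp only [ContinuousMap.coe_mk] at h2
    erw [Path.map_trans, Path.map_trans, hq] at h2
    exact h2
  refine key (e ∘ e.symm) (by fun_prop) (by ext; simp) p ?_
  have := Path.Homotopic.Quotient.eq.2 ((Path.Homotopic.Quotient.exact hp).map ⟨e, e.continuous⟩)
  exact this

theorem HasTrivialCenterAt.of_pathConnected {X : Type*} [TopologicalSpace X] [PathConnectedSpace X]
    {x : X} (h : HasTrivialCenterAt x) (y : X) : HasTrivialCenterAt y := by
  rw [← center_fundamentalGroup_eq_bot_iff] at h ⊢
  exact (FundamentalGroup.fundamentalGroupMulEquivOfPathConnected x y).center_eq_bot h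

/-- The two-dimensional torus. -/
abbrev UnitTorus : Type := UnitAddCircle × UnitAddCircle

namespace UnitTorus

/-- The projection of the plane onto the torus. -/
def proj (v : ℝ × ℝ) : UnitTorus := ((v.1 : UnitAddCircle), (v.2 : UnitAddCircle))

theorem continuous_proj : Continuous proj :=
  ((AddCircle.continuous_mk' 1).comp continuous_fst).prodMk
    ((AddCircle.continuous_mk' 1).comp continuous_snd)

theorem proj_zero : proj 0 = 0 := rfl

theorem proj_sub (v w : ℝ × ℝ) : proj v - proj w = proj (v - w) := rfl

theorem norm_coe_le (u : ℝ) : ‖(u : UnitAddCircle)‖ ≤ |u| :=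
  QuotientAddGroup.norm_mk_le_norm

theorem norm_proj_le (v : ℝ × ℝ) : ‖proj v‖ ≤ ‖v‖ :=
  max_le_max (norm_coe_le v.1) (norm_coe_le v.2)

/-- The shortest lift of a point of the torus. -/
noncomputable def lift (w : UnitTorus) : ℝ × ℝ :=
  (UnitAddCircle.rep (-1 / 2) w.1, UnitAddCircle.rep (-1 / 2) w.2)

theorem proj_lift (w : UnitTorus) : proj (lift w) = w :=
  Prod.ext (UnitAddCircle.coe_rep _ _) (UnitAddCircle.coe_rep _ _)

theorem abs_rep (x : UnitAddCircle) : |UnitAddCircle.rep (-1 / 2) x| = ‖x‖ := by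
  have h : UnitAddCircle.rep (-1 / 2) x ∈ Set.Ico (-1 / 2 : ℝ) (-1 / 2 + 1) :=
    (AddCircle.equivIco 1 (-1 / 2) x).2
  conv_rhs => rw [← UnitAddCircle.coe_rep (-1 / 2) x]
  refine ((AddCircle.norm_coe_eq_abs_iff 1 one_ne_zero).2 ?_).symm
  rw [abs_one, abs_le]
  exact ⟨by linarith [h.1], by linarith [h.2]⟩

theorem norm_lift (w : UnitTorus) : ‖lift w‖ = ‖w‖ := by
  simp [Prod.norm_def, lift, abs_rep]

theorem lift_zero : lift 0 = 0 := by
  rw [← norm_eq_zero, norm_lift, norm_zero]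

theorem ne_coe_half {x : UnitAddCircle} (h : ‖x‖ < 1 / 2) : x ≠ ((-1 / 2 : ℝ) : UnitAddCircle) := by
  rintro rfl
  rw [(AddCircle.norm_coe_eq_abs_iff 1 one_ne_zero).2 (by norm_num)] at h
  norm_num at h

theorem continuous_lift {C : Type*} [TopologicalSpace C] {w : C → UnitTorus} (hw : Continuous w)
    (h : ∀ c, ‖w c‖ < 1 / 2) : Continuous fun c => lift (w c) :=
  ((UnitAddCircle.continuousOn_rep _).comp_continuous (by fun_prop) fun c =>
      ne_coe_half ((norm_fst_le _).trans_lt (h c))).prodMk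
    ((UnitAddCircle.continuousOn_rep _).comp_continuous (by fun_prop) fun c =>
      ne_coe_half ((norm_snd_le _).trans_lt (h c)))

/-- The bump of height one and radius `δ` around the origin. -/
noncomputable def bump (δ : ℝ) (w : UnitTorus) : ℝ := max 0 (1 - ‖w‖ / δ)

theorem abs_bump_sub_le {δ : ℝ} (hδ : 0 < δ) (w w' : UnitTorus) :
    |bump δ w - bump δ w'| ≤ ‖w - w'‖ / δ := by
  refine (abs_max_sub_max_le_max _ _ _ _).trans (max_le (by simp; positivity) ?_)
  rw [show 1 - ‖w‖ / δ - (1 - ‖w'‖ / δ) = (‖w'‖ - ‖w‖) / δ by ring, abs_div, abs_of_pos hδ]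
  gcongr
  rw [norm_sub_rev]
  exact abs_norm_sub_norm_le _ _

theorem continuous_bump (δ : ℝ) : Continuous (bump δ) := by
  unfold bump
  fun_prop

/-- The bump function displacing `a` by `v` and supported in the ball of radius `δ` around `a`. -/
noncomputable def displacement (δ : ℝ) (a : UnitTorus) (v : ℝ × ℝ) (z : UnitTorus) : UnitTorus :=
  proj (bump δ (z - a) • v)

theorem norm_displacement_sub_le {δ : ℝ} (hδ : 0 < δ) (a : UnitTorus) (v : ℝ × ℝ)
    (z z' : UnitTorus) :
    ‖displacement δ a v z - displacement δ a v z'‖ ≤ ‖v‖ / δ * ‖z - z'‖ := by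
  rw [displacement, displacement, proj_sub, ← sub_smul]
  refine (norm_proj_le _).trans ?_
  rw [norm_smul, Real.norm_eq_abs]
  calc _ ≤ ‖z - z'‖ / δ * ‖v‖ := by
        gcongr
        simpa using abs_bump_sub_le hδ (z - a) (z' - a)
    _ = _ := by ring

theorem displacement_self (δ : ℝ) (a : UnitTorus) (v : ℝ × ℝ) : displacement δ a v a = proj v := by
  simp [displacement, bump]

theorem displacement_of_le {δ : ℝ} (hδ : 0 < δ) {a z : UnitTorus} (v : ℝ × ℝ) (h : δ ≤ ‖z - a‖) :
    displacement δ a v z = 0 := by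
  have : bump δ (z - a) = 0 := max_eq_left (sub_nonpos.2 ((one_le_div hδ).2 h))
  rw [displacement, this, zero_smul, proj_zero]

theorem bijective_add_displacement {δ : ℝ} (hδ : 0 < δ) (a : UnitTorus) {v : ℝ × ℝ}
    (hv : ‖v‖ < δ) : Function.Bijective fun z => z + displacement δ a v z := by
  have hk : ‖v‖ / δ < 1 := (div_lt_one hδ).2 hv
  constructor
  · intro z z' h
    have h' : z - z' = displacement δ a v z' - displacement δ a v z := by
      rw [sub_eq_sub_iff_add_eq_add]
      simpa [add_comm] using h
    have := norm_displacement_sub_le hδ a v z' z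
    rw [← h', norm_sub_rev z'] at this
    by_contra hne
    nlinarith [norm_pos_iff.2 (sub_ne_zero.2 hne)]
  · intro w
    have hc : ContractingWith ⟨‖v‖ / δ, by positivity⟩ fun z => w - displacement δ a v z := by
      refine ⟨by exact_mod_cast hk, LipschitzWith.of_dist_le_mul fun z z' => ?_⟩
      rw [dist_eq_norm, dist_eq_norm, sub_sub_sub_cancel_left, ← norm_neg, neg_sub]
      exact norm_displacement_sub_le hδ a v z z'
    refine ⟨hc.fixedPoint _, ?_⟩
    have := hc.fixedPoint_isFixedPt
    exact (eq_sub_iff_add_eq.1 this.symm)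

/-- A continuous family of self-homeomorphisms of the torus, fixing `S`, moving `a` to `b`, and
stationary over `K`. -/
def IsPush {C : Type*} [TopologicalSpace C] (S : Set UnitTorus) (K : Set C) (a b : C → UnitTorus) :
    Prop :=
  ∃ Ψ : C × UnitTorus ≃ₜ C × UnitTorus, (∀ x, (Ψ x).1 = x.1) ∧
    (∀ c, ∀ z ∈ S, Ψ (c, z) = (c, z)) ∧ (∀ c, Ψ (c, a c) = (c, b c)) ∧
    ∀ c ∈ K, ∀ z, Ψ (c, z) = (c, z)

section Push

variable {C : Type*} [TopologicalSpace C] {S : Set UnitTorus} {K : Set C} {a b d : C → UnitTorus}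

theorem IsPush.refl (a : C → UnitTorus) : IsPush S K a a :=
  ⟨.refl _, by simp, by simp, by simp, by simp⟩

theorem IsPush.trans (h : IsPush S K a b) (h' : IsPush S K b d) : IsPush S K a d := by
  obtain ⟨Ψ, h1, h2, h3, h4⟩ := h
  obtain ⟨Ψ', h1', h2', h3', h4'⟩ := h'
  refine ⟨Ψ.trans Ψ', fun x => ?_, fun c z hz => ?_, fun c => ?_, fun c hc z => ?_⟩
  · simp [h1, h1']
  · simp [h2 c z hz, h2' c z hz]
  · simp [h3, h3']
  · simp [h4 c hc, h4' c hc]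

theorem isPush_of_norm_lt [CompactSpace C] [T2Space C] (ha : Continuous a) (hb : Continuous b)
    {δ : ℝ} (hδ : 0 < δ) (hδ' : δ ≤ 1 / 2) (hab : ∀ c, ‖b c - a c‖ < δ)
    (hS : ∀ c, ∀ z ∈ S, δ ≤ ‖z - a c‖) (hK : ∀ c ∈ K, a c = b c) : IsPush S K a b := by
  let φ : C → UnitTorus → UnitTorus := fun c z => z + displacement δ (a c) (lift (b c - a c)) z
  have hφ : ∀ c, Function.Bijective (φ c) := fun c =>
    bijective_add_displacement hδ (a c) (by rw [norm_lift]; exact hab c)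
  have hl : Continuous fun c => lift (b c - a c) :=
    continuous_lift (hb.sub ha) fun c => (hab c).trans_le hδ'
  have hc : Continuous fun x : C × UnitTorus => (x.1, φ x.1 x.2) := by
    have h1 := continuous_bump δ
    have h2 := continuous_proj
    have : Continuous fun x : C × UnitTorus =>
        proj (bump δ (x.2 - a x.1) • lift (b x.1 - a x.1)) :=
      h2.comp ((h1.comp (by fun_prop)).smul (hl.comp continuous_fst))
    exact continuous_fst.prodMk (continuous_snd.add this)
  have hbij : Function.Bijective fun x : C × UnitTorus => (x.1, φ x.1 x.2) := by
    constructor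
    · rintro ⟨c, z⟩ ⟨c', z'⟩ h
      obtain ⟨rfl, h⟩ := Prod.ext_iff.1 h
      exact Prod.ext rfl ((hφ c).1 h)
    · rintro ⟨c, z⟩
      obtain ⟨w, rfl⟩ := (hφ c).2 z
      exact ⟨(c, w), rfl⟩
  refine ⟨Continuous.homeoOfEquivCompactToT2 (f := Equiv.ofBijective _ hbij) hc, fun x => rfl,
    fun c z hz => Prod.ext rfl ?_, fun c => Prod.ext rfl ?_, fun c hc z => Prod.ext rfl ?_⟩
  · change z + displacement _ _ _ z = z
    rw [displacement_of_le hδ _ (hS c z hz), add_zero]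
  · change a c + displacement _ _ _ (a c) = b c
    rw [displacement_self, proj_lift, add_sub_cancel]
  · change z + displacement _ _ _ z = z
    rw [hK c hc, sub_self, lift_zero, displacement, smul_zero, proj_zero, add_zero]

theorem isPush_homotopy (hS : S.Finite) (β : C(I × I, UnitTorus)) (hβ : ∀ c, β c ∉ S) :
    IsPush S {c | c.2 = 0 ∨ ∀ t, β (c.1, t) = β (c.1, 0)} (fun c => β (c.1, 0)) β := by
  obtain ⟨r, hr, hrS⟩ := Metric.exists_pos_forall_lt_edist (isCompact_range β.continuous) hS.isClosed
    (Set.disjoint_left.2 fun x ⟨c, hc⟩ hx => hβ c (hc ▸ hx))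
  set δ : ℝ := min r (1 / 2) with hδ
  have hδ0 : 0 < δ := lt_min hr (by norm_num)
  obtain ⟨ε, hε, hu⟩ := Metric.uniformContinuous_iff.1
    (CompactSpace.uniformContinuous_of_continuous β.continuous) δ hδ0
  obtain ⟨N, hN⟩ := exists_nat_one_div_lt hε
  let b : ℕ → I × I → UnitTorus := fun n c =>
    β (c.1, Set.projIcc 0 1 zero_le_one (min c.2 (n * (1 / (N + 1)))))
  have hb : ∀ n, Continuous (b n) := fun n => by
    have : Continuous (Set.projIcc (0 : ℝ) 1 zero_le_one) := continuous_projIcc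
    fun_prop
  have h0 : b 0 = fun c => β (c.1, 0) := by
    ext1 c
    simp [b, c.2.2.1]
  have h1 : b (N + 1) = β := by
    ext1 c
    have : ((N + 1 : ℕ) : ℝ) * (1 / (N + 1)) = 1 := by
      push_cast
      field_simp
    simp only [b, this, min_eq_left c.2.2.2, Set.projIcc_val]
  suffices ∀ n, IsPush S {c : I × I | c.2 = 0 ∨ ∀ t, β (c.1, t) = β (c.1, 0)} (b 0) (b n) by
    have := this (N + 1)
    rwa [h0, h1] at this
  intro n
  induction n with
  | zero => exact .refl _
  | succ n ih =>
    refine ih.trans (isPush_of_norm_lt (hb n) (hb (n + 1)) hδ0 (min_le_right _ _) (fun c => ?_)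
      (fun c z hz => ?_) ?_)
    · rw [← dist_eq_norm]
      refine hu ?_
      rw [Prod.dist_eq, dist_self]
      refine max_lt hε ((Set.abs_projIcc_sub_projIcc zero_le_one).trans
        (abs_min_sub_min_le_max _ _ _ _) |>.trans_lt (max_lt (by simpa using hε) ?_))
      rw [← sub_mul, Nat.cast_add_one, add_sub_cancel_left, one_mul, abs_of_pos (by positivity)]
      exact hN
    · rw [← dist_eq_norm, dist_comm]
      have := hrS (b n c) ⟨_, rfl⟩ z hz
      rw [edist_nndist, ENNReal.coe_lt_coe] at this
      exact (min_le_left _ _).trans (NNReal.coe_le_coe.2 this.le)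
    · rintro c (hc | hc)
      · simp only [b, hc, Set.Icc.coe_zero]
        rw [min_eq_left (by positivity), min_eq_left (by positivity)]
      · simp only [b, hc]

end Push

end UnitTorus

namespace UnitTorus

variable {S : Set UnitTorus}

theorem surjective_proj : Function.Surjective proj := fun w => ⟨lift w, proj_lift w⟩

theorem countable_preimage_coe (x : UnitAddCircle) :
    {u : ℝ | (u : UnitAddCircle) = x}.Countable := by
  refine (Set.countable_range fun n : ℤ => UnitAddCircle.rep 0 x + n).mono fun u hu => ?_
  rw [Set.mem_ofPred_eq, ← UnitAddCircle.coe_rep 0 x, eq_comm] at hu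
  obtain ⟨n, hn⟩ := AddSubgroup.mem_zmultiples_iff.1 (QuotientAddGroup.eq.1 hu)
  refine ⟨n, ?_⟩
  simp only [zsmul_eq_mul, mul_one] at hn
  simp [hn]

theorem isPathConnected_compl (hS : S.Finite) : IsPathConnected Sᶜ := by
  have hc : (proj ⁻¹' S).Countable := by
    rw [← Set.biUnion_preimage_singleton]
    refine hS.countable.biUnion fun x _ => ?_
    refine ((countable_preimage_coe x.1).prod (countable_preimage_coe x.2)).mono fun v hv => ?_
    exact Prod.ext_iff.1 hv
  have hr : 1 < Module.rank ℝ (ℝ × ℝ) := by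
    rw [rank_prod', Module.rank_self]
    norm_num
  have := (hc.isPathConnected_compl_of_one_lt_rank hr).image continuous_proj
  rwa [← Set.preimage_compl, Set.image_preimage_eq _ surjective_proj] at this

theorem pathConnectedSpace_compl (hS : S.Finite) : PathConnectedSpace ↥Sᶜ :=
  isPathConnected_iff_pathConnectedSpace.1 (isPathConnected_compl hS)

theorem exists_homeomorph (hS : S.Finite) {a b : UnitTorus} (ha : a ∉ S) (hb : b ∉ S) :
    ∃ e : UnitTorus ≃ₜ UnitTorus, (∀ z ∈ S, e z = z) ∧ e a = b := by
  obtain ⟨γ, hγ⟩ := (isPathConnected_compl hS).joinedIn a ha b hb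
  obtain ⟨Ψ, h1, h2, h3, -⟩ := isPush_homotopy hS ⟨fun c : I × I => γ c.2, by fun_prop⟩ fun c => hγ c.2
  have h1' : ∀ x, (Ψ.symm x).1 = x.1 := fun x => by
    rw [← h1, Ψ.apply_symm_apply]
  let c : I × I := (0, 1)
  refine ⟨⟨⟨fun z => (Ψ (c, z)).2, fun z => (Ψ.symm (c, z)).2, fun z => ?_, fun z => ?_⟩,
    by fun_prop, by fun_prop⟩, fun z hz => ?_, ?_⟩
  · have : (c, (Ψ (c, z)).2) = Ψ (c, z) := Prod.ext (h1 (c, z)).symm rfl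
    simp only [this, Ψ.symm_apply_apply]
  · have : (c, (Ψ.symm (c, z)).2) = Ψ.symm (c, z) := Prod.ext (h1' (c, z)).symm rfl
    simp only [this, Ψ.apply_symm_apply]
  · exact congrArg Prod.snd (h2 c z hz)
  · have := congrArg Prod.snd (h3 c)
    simpa [c] using this

theorem exists_homeomorph_fst_eq_zero (hS : S.Finite) :
    ∃ e : UnitTorus ≃ₜ UnitTorus, ∀ z ∈ S, (e z).1 = 0 := by
  induction S, hS using Set.Finite.induction_on with
  | empty => exact ⟨.refl _, by simp⟩
  | @insert a S ha hS ih =>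
    obtain ⟨e, he⟩ := ih
    have := UnitAddCircle.infinite
    obtain ⟨y, hy⟩ := ((hS.image e).image Prod.snd).infinite_compl.nonempty
    obtain ⟨e', h1, h2⟩ := exists_homeomorph (hS.image e) (a := e a) (b := (0, y))
      (by simpa using ha) fun h => hy ⟨_, h, rfl⟩
    refine ⟨e.trans e', ?_⟩
    rintro z (rfl | hz)
    · simp [h2]
    · simp [h1 (e z) ⟨z, hz, rfl⟩, he z hz]

theorem exists_homeomorph_image_eq (hS : S.Finite) (hne : S.Nonempty) :
    ∃ (e : UnitTorus ≃ₜ UnitTorus) (Y : Set UnitAddCircle), Y.Finite ∧ 0 ∈ Y ∧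
      ∀ z, z ∈ S ↔ e z ∈ ({0} : Set UnitAddCircle) ×ˢ Y := by
  obtain ⟨e, he⟩ := exists_homeomorph_fst_eq_zero hS
  obtain ⟨a, ha⟩ := hne
  let e' := e.trans (Homeomorph.subRight (e a))
  refine ⟨e', Set.image Prod.snd (Set.image e' S), (hS.image _).image _, ⟨0, ⟨a, ha, ?_⟩, rfl⟩,
    fun z => ⟨fun hz =>
    ⟨?_, _, ⟨z, hz, rfl⟩, rfl⟩, ?_⟩⟩
  · simp [e']
  · simp [e', he z hz, he a ha]
  · rintro ⟨h1, _, ⟨w, hw, rfl⟩, h2⟩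
    have h3 : (e' w).1 = 0 := by simp [e', he w hw, he a ha]
    rwa [← e'.injective (Prod.ext (h3.trans h1.symm) h2)]

theorem hasTrivialCenterAt_compl (hS : S.Finite) (hne : S.Nonempty) (x : ↥Sᶜ) :
    HasTrivialCenterAt x := by
  obtain ⟨e, Y, hY, h0, he⟩ := exists_homeomorph_image_eq hS hne
  let e' : ↥Sᶜ ≃ₜ ↥(({0} : Set UnitAddCircle) ×ˢ Y)ᶜ := e.subtype fun z => not_congr (he z)
  have := pathConnectedSpace_compl ((Set.finite_singleton (0 : UnitAddCircle)).prod hY)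
  exact ((SlitChart.hasTrivialCenterAt_base hY h0).of_pathConnected _).of_homeomorph e'.symm

end UnitTorus

namespace UnitTorus

variable {S : Set UnitTorus} {k : ℕ}

/-- Injective `k`-tuples of points of the torus punctured at `S`. -/
abbrev Conf (S : Set UnitTorus) (k : ℕ) : Type := {f : Fin k → ↥Sᶜ // Function.Injective f}

section Act

variable {C : Type*} [TopologicalSpace C] {Ψ : C × UnitTorus ≃ₜ C × UnitTorus}

/-- The diagonal action on configurations of a family of homeomorphisms fixing the punctures. -/
def act (h1 : ∀ x, (Ψ x).1 = x.1) (h2 : ∀ c, ∀ z ∈ S, Ψ (c, z) = (c, z)) (c : C) (f : Conf S k) :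
    Conf S k :=
  have hinj : Function.Injective fun z => (Ψ (c, z)).2 := fun z w h =>
    congrArg Prod.snd (Ψ.injective (Prod.ext ((h1 (c, z)).trans (h1 (c, w)).symm) h))
  ⟨fun i => ⟨(Ψ (c, f.1 i)).2, fun hz => (f.1 i).2 <| by
    have h : (Ψ (c, (f.1 i).1)).2 = (f.1 i).1 :=
      hinj (congrArg Prod.snd (h2 c _ hz) :)
    exact h ▸ hz⟩, fun i j h => f.2 (Subtype.ext (hinj (Subtype.ext_iff.1 h)))⟩

theorem act_apply (h1 : ∀ x, (Ψ x).1 = x.1) (h2 : ∀ c, ∀ z ∈ S, Ψ (c, z) = (c, z)) (c : C)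
    (f : Conf S k) (i : Fin k) : ((act h1 h2 c f).1 i).1 = (Ψ (c, (f.1 i).1)).2 := rfl

theorem continuous_act (h1 : ∀ x, (Ψ x).1 = x.1) (h2 : ∀ c, ∀ z ∈ S, Ψ (c, z) = (c, z)) :
    Continuous fun x : C × Conf S k => act h1 h2 x.1 x.2 := by
  refine Continuous.subtype_mk (continuous_pi fun i => Continuous.subtype_mk ?_ _) _
  exact continuous_snd.comp (Ψ.continuous.comp (continuous_fst.prodMk
    (continuous_subtype_val.comp ((continuous_apply i).comp
      (continuous_subtype_val.comp continuous_snd)))))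

theorem Conf.ext {f g : Conf S k} (h : ∀ i, (f.1 i).1 = (g.1 i).1) : f = g :=
  Subtype.ext (funext fun i => Subtype.ext (h i))

end Act

theorem hasIsotopyLifting_conf (hS : S.Finite) :
    HasIsotopyLifting fun f : Conf S (k + 1) => f.1 0 := by
  intro β
  obtain ⟨Ψ, h1, h2, h3, h4⟩ := isPush_homotopy hS ⟨fun c => (β c).1, by fun_prop⟩ fun c => (β c).2
  have h1' : ∀ x, (Ψ.symm x).1 = x.1 := fun x => by
    rw [← h1, Ψ.apply_symm_apply]
  have h2' : ∀ c, ∀ z ∈ S, Ψ.symm (c, z) = (c, z) := fun c z hz => by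
    rw [Ψ.symm_apply_eq, h2 c z hz]
  have h4' : ∀ c, c.2 = 0 ∨ (∀ t, β (c.1, t) = β (c.1, 0)) → ∀ z, Ψ (c, z) = (c, z) :=
    fun c hc => h4 c (hc.imp_right fun h t => congrArg Subtype.val (h t))
  have h5 : ∀ c, c.2 = 0 ∨ (∀ t, β (c.1, t) = β (c.1, 0)) → ∀ z, Ψ.symm (c, z) = (c, z) :=
    fun c hc z => by rw [Ψ.symm_apply_eq, h4' c hc]
  refine ⟨act h1 h2, act h1' h2', continuous_act h1 h2, continuous_act h1' h2', fun c e => ?_,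
    fun s e => ?_, fun s hs t e => ?_, fun s hs t e => ?_, fun s e => ?_, fun s t e he => ?_,
    fun s t e he => ?_⟩
  · refine Conf.ext fun i => ?_
    have : (c, (Ψ.symm (c, (e.1 i).1)).2) = Ψ.symm (c, (e.1 i).1) :=
      Prod.ext (h1' (c, (e.1 i).1)).symm rfl
    rw [act_apply, act_apply, this, Ψ.apply_symm_apply]
  · exact Conf.ext fun i => by rw [act_apply, h4' _ (.inl rfl)]
  · exact Conf.ext fun i => by rw [act_apply, h4' _ (.inr hs)]
  · exact Conf.ext fun i => by rw [act_apply, h5 _ (.inr hs)]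
  · exact Conf.ext fun i => by rw [act_apply, h5 _ (.inl rfl)]
  · refine Subtype.ext ?_
    change e.1 0 = _ at he
    rw [act_apply, he]
    exact congrArg Prod.snd (h3 (s, t))
  · refine Subtype.ext ?_
    change e.1 0 = _ at he
    rw [act_apply, he]
    exact congrArg Prod.snd (Ψ.symm_apply_eq.2 (h3 (s, t)).symm)

/-- The configurations with prescribed first point. -/
def confFiber (b : ↥Sᶜ) :
    {f : Conf S (k + 1) // f.1 0 = b} ≃ₜ Conf (insert b.1 S) k where
  toFun f := ⟨fun i => ⟨(f.1.1 i.succ).1, by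
    rintro (h | h)
    · exact Fin.succ_ne_zero i (f.1.2 (Subtype.ext (h.trans (congrArg Subtype.val f.2.symm))))
    · exact (f.1.1 i.succ).2 h⟩, fun i j h =>
      Fin.succ_injective _ (f.1.2 (Subtype.ext (Subtype.ext_iff.1 h :)))⟩
  invFun g := ⟨⟨Fin.cons b fun i => ⟨(g.1 i).1, fun h => (g.1 i).2 (.inr h)⟩,
    Fin.cons_injective_iff.2 ⟨fun ⟨i, hi⟩ => (g.1 i).2 (.inl (congrArg Subtype.val hi)),
      fun i j h => g.2 (Subtype.ext (Subtype.ext_iff.1 h :))⟩⟩, rfl⟩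
  left_inv f := by
    obtain ⟨f, rfl⟩ := f
    refine Subtype.ext (Conf.ext fun i => ?_)
    cases i using Fin.cases <;> rfl
  right_inv g := rfl
  continuous_toFun := Continuous.subtype_mk (continuous_pi fun i => Continuous.subtype_mk
    (continuous_subtype_val.comp ((continuous_apply i.succ).comp
      (continuous_subtype_val.comp continuous_subtype_val))) _) _
  continuous_invFun := by
    refine Continuous.subtype_mk (Continuous.subtype_mk (continuous_pi fun i => ?_) _) _
    cases i using Fin.cases with
    | zero => exact continuous_const
    | succ i =>
      simp only [Fin.cons_succ]
      exact Continuous.subtype_mk (continuous_subtype_val.comp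
        ((continuous_apply i).comp continuous_subtype_val)) _

theorem pathConnectedSpace_conf_and_hasTrivialCenterAt (k : ℕ) :
    ∀ S : Set UnitTorus, S.Finite → S.Nonempty →
      PathConnectedSpace (Conf S k) ∧ ∀ y : Conf S k, HasTrivialCenterAt y := by
  induction k with
  | zero =>
    intro S _ _
    have : Subsingleton (Conf S 0) := ⟨fun f g => Conf.ext fun i => i.elim0⟩
    have : Nonempty (Conf S 0) := ⟨⟨fun i => i.elim0, fun i => i.elim0⟩⟩
    refine ⟨⟨this, fun x y => Subsingleton.elim x y ▸ Joined.refl x⟩, fun y γ _ => ?_⟩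
    induction γ using Path.Homotopic.Quotient.ind with | mk p
    exact congrArg Path.Homotopic.Quotient.mk (Path.ext (funext fun t => Subsingleton.elim _ _))
  | succ k ih =>
    intro S hS hne
    have := pathConnectedSpace_compl hS
    have hfib : ∀ b : ↥Sᶜ, PathConnectedSpace {f : Conf S (k + 1) // f.1 0 = b} ∧
        ∀ f : {f : Conf S (k + 1) // f.1 0 = b}, HasTrivialCenterAt f := fun b => by
      obtain ⟨h1, h2⟩ := ih (insert b.1 S) (hS.insert _) (Set.insert_nonempty _ _)
      exact ⟨(confFiber b).symm.surjective.pathConnectedSpace (confFiber b).symm.continuous,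
        fun f => (h2 _).of_homeomorph (confFiber b).symm⟩
    have hl := hasIsotopyLifting_conf (k := k) hS
    obtain ⟨b⟩ := this.nonempty
    obtain ⟨e₀⟩ := (hfib b).1.nonempty
    have := (hfib (e₀.1.1 0)).1
    refine ⟨hl.pathConnectedSpace e₀.1, fun y => ?_⟩
    have := (hfib (y.1 0)).1
    exact hl.hasTrivialCenterAt ((continuous_apply 0).comp continuous_subtype_val) y
      (hasTrivialCenterAt_compl hS hne _)
      ((hfib (y.1 0)).2 _)

end UnitTorus

theorem config_space_punctured_torus_pi1_centerless (m : ℕ) (hm : 1 ≤ m)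
    (S : Set ((AddCircle (1 : ℝ)) × (AddCircle (1 : ℝ))))
    (hS : S.Finite) (hcard : hS.toFinset.card = m)
    (k : ℕ) (hk : 1 ≤ k)
    (y : {f : Fin k → ↥(Sᶜ) // Function.Injective f}) :
    Subgroup.center
      (FundamentalGroup {f : Fin k → ↥(Sᶜ) // Function.Injective f} y) = ⊥ := by
  have hne : S.Nonempty := by
    rw [← hS.toFinset_nonempty, ← Finset.card_pos, hcard]
    exact hm
  exact (center_fundamentalGroup_eq_bot_iff y).2
    ((UnitTorus.pathConnectedSpace_conf_and_hasTrivialCenterAt k S hS hne).2 y)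
end
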